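/- arXiv:1101.4373 — 5 statements merged into one kernel-verified Lean document; each statement's English description precedes it below -/
import Mathlib

section
/- Existence of statistical multiresolution estimators: under the stated setting, assume (i) there exists u₀ ∈ U with μ_S(Y − K u₀) ≤ q for every S ∈ 𝒮 (the feasible set is nonempty), and (ii) for every c ∈ ℝ the set {u ∈ U : max_{S∈𝒮} μ_S(Y − K u) + J(u) ≤ c} is bounded. Then the constrained problem `minimize J(u) over all u ∈ U subject to μ_S(Y − K u) ≤ q for every S ∈ 𝒮` has a solution, i.e. there exists û ∈ U with μ_S(Y − K û) ≤ q for all S ∈ 𝒮 and J(û) ≤ J(u) for every u ∈ U satisfying μ_S(Y − K u) ≤ q for all S ∈ 𝒮. -/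
open RealInnerProductSpace

/-- Closed balls of a real Hilbert space are weakly compact. -/
theorem isCompact_toWeakSpace_image_closedBall {U : Type*} [NormedAddCommGroup U]
    [InnerProductSpace ℝ U] [CompleteSpace U] (r : ℝ) :
    IsCompact (toWeakSpace ℝ U '' Metric.closedBall 0 r) := by
  have hg : Continuous fun x : WeakDual ℝ U ↦
      toWeakSpace ℝ U ((InnerProductSpace.toDual ℝ U).symm (WeakDual.toStrongDual x)) := by
    refine WeakBilin.continuous_of_continuous_eval _ fun f ↦ ?_
    refine (WeakDual.eval_continuous ((InnerProductSpace.toDual ℝ U).symm f)).congr fun x ↦ ?_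
    change WeakDual.toStrongDual x ((InnerProductSpace.toDual ℝ U).symm f) =
      f ((InnerProductSpace.toDual ℝ U).symm (WeakDual.toStrongDual x))
    rw [← InnerProductSpace.toDual_symm_apply, real_inner_comm,
      InnerProductSpace.toDual_symm_apply]
  convert (WeakDual.isCompact_closedBall (𝕜 := ℝ) (0 : StrongDual ℝ U) r).image hg using 1
  ext y
  constructor
  · rintro ⟨u, hu, rfl⟩
    refine ⟨StrongDual.toWeakDual (InnerProductSpace.toDual ℝ U u), ?_, by simp⟩
    simpa using hu
  · rintro ⟨x, hx, rfl⟩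
    exact ⟨_, by simpa using hx, rfl⟩

/-- A convex lower semicontinuous function is weakly lower semicontinuous. -/
theorem ConvexOn.lowerSemicontinuous_comp_toWeakSpace_symm {U : Type*} [NormedAddCommGroup U]
    [NormedSpace ℝ U] {J : U → ℝ} (hconv : ConvexOn ℝ Set.univ J)
    (hlsc : LowerSemicontinuous J) :
    LowerSemicontinuous fun x : WeakSpace ℝ U ↦ J ((toWeakSpace ℝ U).symm x) := by
  rw [lowerSemicontinuous_iff_isClosed_preimage]
  intro c
  have hc : Convex ℝ (J ⁻¹' Set.Iic c) := by simpa [Set.preimage] using hconv.convex_le c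
  have h := hc.toWeakSpace_closure ℝ
  rw [(hlsc.isClosed_preimage c).closure_eq] at h
  have h' := closure_eq_iff_isClosed.mp h.symm
  rwa [LinearEquiv.image_eq_preimage_symm] at h'

/-- A continuous linear map into a finite-dimensional space is continuous from the weak topology
to the norm topology. -/
theorem ContinuousLinearMap.continuous_comp_toWeakSpace_symm {U H : Type*}
    [NormedAddCommGroup U] [NormedSpace ℝ U] [NormedAddCommGroup H] [NormedSpace ℝ H]
    [FiniteDimensional ℝ H] (K : U →L[ℝ] H) :
    Continuous fun x : WeakSpace ℝ U ↦ K ((toWeakSpace ℝ U).symm x) := by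
  have : FiniteDimensional ℝ (WeakSpace ℝ H) := (toWeakSpace ℝ H).finiteDimensional
  exact (LinearMap.continuous_of_finiteDimensional
    (toWeakSpace ℝ H).symm.toLinearMap).comp (WeakSpace.map K).continuous

/-- Existence of statistical multiresolution estimators. -/
theorem smre_existence
    {H U ι : Type*}
    [NormedAddCommGroup H] [InnerProductSpace ℝ H] [FiniteDimensional ℝ H]
    [NormedAddCommGroup U] [InnerProductSpace ℝ U] [CompleteSpace U]
    [Fintype ι] [Nonempty ι]
    (K : U →L[ℝ] H) (J : U → ℝ)
    (hJconv : ConvexOn ℝ Set.univ J) (hJlsc : LowerSemicontinuous J)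
    (Y : H) (ω : ι → H) (Λ : H → H) (hΛcont : Continuous Λ) (hΛ0 : Λ 0 = 0)
    (q : ℝ)
    (hfeas : ∃ u₀ : U, ∀ S : ι, abs ⟪ω S, Λ (Y - K u₀)⟫ ≤ q)
    (hbdd : ∀ c : ℝ, Bornology.IsBounded
      {u : U | (⨆ S : ι, abs ⟪ω S, Λ (Y - K u)⟫) + J u ≤ c}) :
    ∃ uhat : U, (∀ S : ι, abs ⟪ω S, Λ (Y - K uhat)⟫ ≤ q) ∧
      ∀ u : U, (∀ S : ι, abs ⟪ω S, Λ (Y - K u)⟫ ≤ q) → J uhat ≤ J u := by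
  obtain ⟨u₀, hu₀⟩ := hfeas
  have hJ := hJconv.lowerSemicontinuous_comp_toWeakSpace_symm hJlsc
  have hK := K.continuous_comp_toWeakSpace_symm
  obtain ⟨r, hr⟩ := (hbdd (q + J u₀)).subset_closedBall 0
  have hmem (u : U) (hu : ∀ S : ι, abs ⟪ω S, Λ (Y - K u)⟫ ≤ q) (hle : J u ≤ J u₀) :
      u ∈ Metric.closedBall 0 r := hr (add_le_add (ciSup_le hu) hle)
  have hclosed : IsClosed {x : WeakSpace ℝ U |
      ∀ S : ι, abs ⟪ω S, Λ (Y - K ((toWeakSpace ℝ U).symm x))⟫ ≤ q} := by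
    rw [Set.ofPred_forall]
    exact isClosed_iInter fun S ↦ isClosed_le
      (continuous_const.inner (hΛcont.comp (continuous_const.sub hK))).abs continuous_const
  have hne : (toWeakSpace ℝ U '' Metric.closedBall 0 r ∩ {x : WeakSpace ℝ U |
      ∀ S : ι, abs ⟪ω S, Λ (Y - K ((toWeakSpace ℝ U).symm x))⟫ ≤ q}).Nonempty :=
    ⟨toWeakSpace ℝ U u₀, Set.mem_image_of_mem _ (hmem u₀ hu₀ le_rfl), by simpa using hu₀⟩
  obtain ⟨x, ⟨-, hx⟩, hmin⟩ := (hJ.lowerSemicontinuousOn _).exists_isMinOn hne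
    ((isCompact_toWeakSpace_image_closedBall r).inter_right hclosed)
  have hmin' (u : U) (hu : ∀ S : ι, abs ⟪ω S, Λ (Y - K u)⟫ ≤ q) (hle : J u ≤ J u₀) :
      J ((toWeakSpace ℝ U).symm x) ≤ J u := by
    simpa using hmin (a := toWeakSpace ℝ U u)
      ⟨Set.mem_image_of_mem _ (hmem u hu hle), by simpa using hu⟩
  refine ⟨(toWeakSpace ℝ U).symm x, hx, fun u hu ↦ ?_⟩
  rcases le_total (J u) (J u₀) with h | h
  · exact hmin' u hu h
  · exact (hmin' u₀ hu₀ le_rfl).trans h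
end

section
/- Existence of a saddle point of the augmented Lagrangian (Theorem 2.1): under the stated setting, assume (i) Slater's condition: there exists u₀ ∈ U such that Y − K u₀ lies in the topological interior of C, and (ii) coercivity: for every c ∈ ℝ the set {u ∈ U : Y − K u ∈ C and J(u) ≤ c} is bounded. Then for every λ > 0 the augmented Lagrangian L_λ possesses a saddle point (û, v̂, p̂) ∈ U × C × H. -/
open RealInnerProductSpace

/-- The augmented Lagrangian `L_λ(u,v;p)`. -/
noncomputable def augLag {U H : Type*}
    [NormedAddCommGroup H] [InnerProductSpace ℝ H]
    [NormedAddCommGroup U] [InnerProductSpace ℝ U]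
    (K : U →L[ℝ] H) (J : U → ℝ) (Y : H) (lam : ℝ) (u : U) (v p : H) : ℝ :=
  (1 / (2 * lam)) * ‖K u + v - Y‖ ^ 2 + J u - ⟪p, K u + v - Y⟫

open Filter Topology in
/-- An antitone sequence of nonempty, closed, convex, bounded subsets of a Hilbert space has
nonempty intersection. -/
theorem nonempty_iInter_of_antitone_convex_bounded {U : Type*}
    [NormedAddCommGroup U] [InnerProductSpace ℝ U] [CompleteSpace U]
    (S : ℕ → Set U) (hanti : Antitone S) (hne : ∀ n, (S n).Nonempty)
    (hclosed : ∀ n, IsClosed (S n)) (hconv : ∀ n, Convex ℝ (S n))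
    (hbdd : Bornology.IsBounded (S 0)) : (⋂ n, S n).Nonempty := by
  have key : ∀ n, ∃ x ∈ S n, ∀ w ∈ S n, ‖w - x‖ ^ 2 ≤ ‖w‖ ^ 2 - ‖x‖ ^ 2 := by
    intro n
    obtain ⟨x, hx, hmin⟩ := exists_norm_eq_iInf_of_complete_convex (hne n)
      (hclosed n).isComplete (hconv n) 0
    refine ⟨x, hx, fun w hw => ?_⟩
    have h := (norm_eq_iInf_iff_real_inner_le_zero (hconv n) hx).1 hmin w hw
    rw [zero_sub, inner_neg_left, inner_sub_right, real_inner_self_eq_norm_sq] at h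
    rw [norm_sub_sq_real, real_inner_comm]
    linarith
  choose x hx hmin using key
  have hstep : ∀ m n, m ≤ n → ‖x n - x m‖ ^ 2 ≤ ‖x n‖ ^ 2 - ‖x m‖ ^ 2 :=
    fun m n hmn => hmin m _ (hanti hmn (hx n))
  have hmono : Monotone fun n => ‖x n‖ ^ 2 := fun m n hmn => by
    have := hstep m n hmn
    have := sq_nonneg ‖x n - x m‖
    show ‖x m‖ ^ 2 ≤ ‖x n‖ ^ 2
    linarith
  obtain ⟨R, hR⟩ := hbdd.exists_norm_le
  have hbd : BddAbove (Set.range fun n => ‖x n‖ ^ 2) := by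
    refine ⟨R ^ 2, ?_⟩
    rintro _ ⟨n, rfl⟩
    exact pow_le_pow_left₀ (norm_nonneg _) (hR _ (hanti (Nat.zero_le n) (hx n))) 2
  have hlim := tendsto_atTop_ciSup hmono hbd
  have hcauchy : CauchySeq x := by
    refine Metric.cauchySeq_iff'.2 fun ε hε => ?_
    obtain ⟨N, hN⟩ := Metric.cauchySeq_iff'.1 hlim.cauchySeq (ε ^ 2) (by positivity)
    refine ⟨N, fun n hn => ?_⟩
    have h1 := (le_abs_self _).trans_lt (hN n hn)
    have h2 := hstep N n hn
    rw [dist_eq_norm]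
    exact lt_of_pow_lt_pow_left₀ 2 hε.le (h2.trans_lt h1)
  obtain ⟨y, hy⟩ := cauchySeq_tendsto_of_complete hcauchy
  refine ⟨y, Set.mem_iInter.2 fun n => (hclosed n).mem_of_tendsto hy ?_⟩
  filter_upwards [eventually_ge_atTop n] with m hm using hanti hm (hx m)

/-- A convex lower semicontinuous function whose sublevel sets on a nonempty closed convex set `F`
of a Hilbert space are bounded attains its minimum on `F`. -/
theorem exists_isMinOn_of_convexOn_of_bounded_sublevel {U : Type*}
    [NormedAddCommGroup U] [InnerProductSpace ℝ U] [CompleteSpace U]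
    {J : U → ℝ} (hJconv : ConvexOn ℝ Set.univ J) (hJlsc : LowerSemicontinuous J)
    {F : Set U} (hFne : F.Nonempty) (hFclosed : IsClosed F) (hFconv : Convex ℝ F)
    (hbdd : ∀ c : ℝ, Bornology.IsBounded {u : U | u ∈ F ∧ J u ≤ c}) :
    ∃ x ∈ F, IsMinOn J F x := by
  have key : ∀ c : ℕ → ℝ, Antitone c → (∀ n, ∃ u ∈ F, J u ≤ c n) →
      ∃ x ∈ F, ∀ n, J x ≤ c n := by
    intro c hc hne
    obtain ⟨x, hx⟩ := nonempty_iInter_of_antitone_convex_bounded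
      (fun n => {u : U | u ∈ F ∧ J u ≤ c n})
      (fun m n hmn u hu => ⟨hu.1, hu.2.trans (hc hmn)⟩) hne
      (fun n => hFclosed.inter (hJlsc.isClosed_preimage (c n)))
      (fun n => hFconv.inter
        (show Convex ℝ {u | J u ≤ c n} by simpa using hJconv.convex_le (c n)))
      (hbdd _)
    rw [Set.mem_iInter] at hx
    exact ⟨x, (hx 0).1, fun n => (hx n).2⟩
  have hbelow : BddBelow (J '' F) := by
    by_contra hb
    obtain ⟨x, -, hx⟩ := key (fun n => -(n : ℝ)) (fun m n hmn => by simpa using hmn) (by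
      intro n
      by_contra! h
      refine hb ⟨-(n : ℝ), ?_⟩
      rintro _ ⟨u, hu, rfl⟩
      exact (h u hu).le)
    obtain ⟨n, hn⟩ := exists_nat_gt (-J x)
    have := hx n
    linarith
  obtain ⟨x, hxF, hx⟩ := key (fun n => sInf (J '' F) + 1 / ((n : ℝ) + 1))
    (fun m n hmn => by
      have := Nat.one_div_le_one_div (α := ℝ) hmn
      show sInf (J '' F) + 1 / ((n : ℝ) + 1) ≤ sInf (J '' F) + 1 / ((m : ℝ) + 1)
      linarith)
    (fun n => by
      obtain ⟨_, ⟨u, hu, rfl⟩, h⟩ := exists_lt_of_csInf_lt (hFne.image J)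
        (lt_add_of_pos_right (sInf (J '' F)) (Nat.one_div_pos_of_nat (α := ℝ) (n := n)))
      exact ⟨u, hu, h.le⟩)
  refine ⟨x, hxF, fun u hu => ?_⟩
  have h1 : J x ≤ sInf (J '' F) := by
    refine le_of_forall_pos_le_add fun ε hε => ?_
    obtain ⟨n, hn⟩ := exists_nat_one_div_lt hε
    have := hx n
    linarith
  exact h1.trans (csInf_le hbelow ⟨u, hu, rfl⟩)

/-- Existence of a Lagrange multiplier under Slater's condition: if `m` is a lower bound of `J` on
`{u | Y - K u ∈ C}`, then `m` is a lower bound of some Lagrangian `J u - ⟪p, K u + v - Y⟫`. -/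
theorem exists_lagrange_multiplier {H U : Type*}
    [NormedAddCommGroup H] [InnerProductSpace ℝ H] [CompleteSpace H]
    [NormedAddCommGroup U] [InnerProductSpace ℝ U]
    (K : U →L[ℝ] H) {J : U → ℝ} (hJconv : ConvexOn ℝ Set.univ J)
    (Y : H) {C : Set H} (hCconv : Convex ℝ C)
    (hslater : ∃ u₀ : U, Y - K u₀ ∈ interior C)
    {m : ℝ} (hm : ∀ u, Y - K u ∈ C → m ≤ J u) :
    ∃ p : H, ∀ u, ∀ v ∈ C, m ≤ J u - ⟪p, K u + v - Y⟫ := by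
  obtain ⟨u₀, hu₀⟩ := hslater
  let A : Set (H × ℝ) := {z | ∃ u, ∃ v ∈ C, z.1 = K u + v - Y ∧ J u - m < z.2}
  have hAconv : Convex ℝ A := by
    rintro ⟨_, r₁⟩ ⟨u₁, v₁, hv₁, rfl, h₁⟩ ⟨_, r₂⟩ ⟨u₂, v₂, hv₂, rfl, h₂⟩ a b ha hb hab
    refine ⟨a • u₁ + b • u₂, a • v₁ + b • v₂, hCconv hv₁ hv₂ ha hb hab, ?_, ?_⟩
    · have hY : Y = a • Y + b • Y := by rw [← add_smul, hab, one_smul]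
      simp only [Prod.fst_add, Prod.smul_fst, map_add, map_smul]
      nth_rw 3 [hY]
      module
    · have hJ := hJconv.2 (Set.mem_univ u₁) (Set.mem_univ u₂) ha hb hab
      simp only [smul_eq_mul, Prod.snd_add, Prod.smul_snd] at hJ ⊢
      have hmm : m = a * m + b * m := by rw [← add_mul, hab, one_mul]
      simp only at h₁ h₂
      rcases ha.eq_or_lt with rfl | ha'
      · have hb1 : b = 1 := by linarith
        subst hb1
        linarith
      · nlinarith [mul_lt_mul_of_pos_left h₁ ha', mul_le_mul_of_nonneg_left h₂.le hb]
  have hzero : (0 : H × ℝ) ∉ A := by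
    rintro ⟨u, v, hv, h0, hlt⟩
    have hvu : Y - K u = v := by
      have h0' : (0 : H) = K u + v - Y := h0
      rw [sub_eq_iff_eq_add', ← sub_eq_zero, ← neg_eq_zero, neg_sub, ← h0']
    have := hm u (hvu ▸ hv)
    simp only [Prod.snd_zero] at hlt
    linarith
  have hint : ((0 : H), J u₀ - m + 1) ∈ interior A := by
    rw [mem_interior]
    refine ⟨((fun z : H × ℝ => z.1 + (Y - K u₀)) ⁻¹' interior C) ∩
      ((fun z : H × ℝ => z.2) ⁻¹' Set.Ioi (J u₀ - m)), ?_, ?_, ?_⟩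
    · rintro ⟨w, r⟩ ⟨hw, hr⟩
      exact ⟨u₀, w + (Y - K u₀), interior_subset hw, by simp only; abel, hr⟩
    · exact (isOpen_interior.preimage (by fun_prop)).inter (isOpen_Ioi.preimage continuous_snd)
    · exact ⟨by simpa using hu₀, by simp⟩
  obtain ⟨f, hf⟩ := geometric_hahn_banach_open_point hAconv.interior isOpen_interior
    (fun h => hzero (interior_subset h))
  simp only [map_zero] at hf
  have hfA : ∀ z ∈ A, f z ≤ 0 := by
    intro z hz
    have hz' : z ∈ closure (interior A) := by
      rw [hAconv.closure_interior_eq_closure_of_nonempty_interior ⟨_, hint⟩]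
      exact subset_closure hz
    exact closure_minimal (fun y hy => (hf y hy).le)
      (isClosed_Iic.preimage f.continuous) hz'
  let φ : StrongDual ℝ H := f.comp (ContinuousLinearMap.inl ℝ H ℝ)
  let a : ℝ := f (0, 1)
  have hsplit : ∀ w r, f (w, r) = φ w + r * a := by
    intro w r
    have : ((w, r) : H × ℝ) = (w, 0) + r • ((0 : H), (1 : ℝ)) := by simp
    rw [this, map_add, map_smul]
    rfl
  have hu₀m := hm u₀ (interior_subset hu₀)
  have ha : a < 0 := by
    have h := hf _ hint
    rw [hsplit, map_zero, zero_add] at h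
    exact neg_of_mul_neg_right h (by linarith)
  refine ⟨(InnerProductSpace.toDual ℝ H).symm ((-a)⁻¹ • φ), fun u v hv => ?_⟩
  rw [InnerProductSpace.toDual_symm_apply, smul_apply, smul_eq_mul]
  set w := K u + v - Y
  have hle : φ w ≤ (J u - m) * -a := by
    refine le_of_forall_pos_le_add fun ε hε => ?_
    have h := hfA (w, J u - m + ε / -a)
      ⟨u, v, hv, rfl, lt_add_of_pos_right _ (div_pos hε (by linarith))⟩
    rw [hsplit] at h
    have he : ε / -a * a = -ε := by field_simp [ha.ne]
    linarith
  have : (-a)⁻¹ * φ w ≤ J u - m := by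
    rw [inv_mul_le_iff₀ (by linarith)]
    linarith
  linarith

/-- Existence of a saddle point of the augmented Lagrangian (Theorem 2.1). -/
theorem saddle_point_existence
    {H U : Type*}
    [NormedAddCommGroup H] [InnerProductSpace ℝ H] [FiniteDimensional ℝ H]
    [NormedAddCommGroup U] [InnerProductSpace ℝ U] [CompleteSpace U]
    (K : U →L[ℝ] H) (J : U → ℝ)
    (hJconv : ConvexOn ℝ Set.univ J) (hJlsc : LowerSemicontinuous J)
    (Y : H) (C : Set H) (hCne : C.Nonempty) (hCclosed : IsClosed C)
    (hCconv : Convex ℝ C)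
    (lam : ℝ) (hlam : 0 < lam)
    (hslater : ∃ u₀ : U, Y - K u₀ ∈ interior C)
    (hcoercive : ∀ c : ℝ, Bornology.IsBounded {u : U | Y - K u ∈ C ∧ J u ≤ c}) :
    ∃ (uhat : U) (vhat phat : H), vhat ∈ C ∧
      (∀ p : H, augLag K J Y lam uhat vhat p ≤ augLag K J Y lam uhat vhat phat) ∧
      (∀ u : U, ∀ v ∈ C, augLag K J Y lam uhat vhat phat ≤ augLag K J Y lam u v phat) := by
  obtain ⟨u₀, hu₀⟩ := hslater
  have hfconv : Convex ℝ {u : U | Y - K u ∈ C} := by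
    intro x hx y hy a b ha hb hab
    have h := hCconv hx hy ha hb hab
    have hY : a • (Y - K x) + b • (Y - K y) = Y - K (a • x + b • y) := by
      have hY : Y = a • Y + b • Y := by rw [← add_smul, hab, one_smul]
      nth_rw 3 [hY]
      simp only [map_add, map_smul]
      module
    rwa [hY] at h
  obtain ⟨x, hx, hmin⟩ := exists_isMinOn_of_convexOn_of_bounded_sublevel hJconv hJlsc
    (F := {u : U | Y - K u ∈ C}) ⟨u₀, interior_subset (s := C) hu₀⟩
    (hCclosed.preimage (by fun_prop)) hfconv hcoercive
  have := FiniteDimensional.complete ℝ H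
  obtain ⟨p, hp⟩ := exists_lagrange_multiplier K hJconv Y hCconv ⟨u₀, hu₀⟩
    (m := J x) (fun u hu => hmin hu)
  have hfeas : ∀ q : H, augLag K J Y lam x (Y - K x) q = J x := by
    intro q
    simp [augLag]
  refine ⟨x, Y - K x, p, hx, fun q => ?_, fun u v hv => ?_⟩
  · rw [hfeas, hfeas]
  · rw [hfeas, augLag]
    have h1 := hp u v hv
    have h2 : 0 ≤ 1 / (2 * lam) * ‖K u + v - Y‖ ^ 2 := by positivity
    linarith
end

section
/- Convergence of the exact alternating direction method of multipliers (Theorem 2.2): under the stated setting, assume L_λ has a saddle point (û, v̂, p̂), and assume that for all a, b ∈ ℝ the set {u ∈ U : ‖K u‖ ≤ a and J(u) ≤ b} is bounded. Let (u_k, v_k, p_k)_{k≥0} be an exact ADMM sequence. Then: (a) the sequence (u_k, v_k)_{k≥1} is bounded in U × H; (b) Σ_{k≥1} (‖K u_k + v_k − Y‖² + ‖K(u_k − u_{k−1})‖²) < ∞; and (c) every weak cluster point is a solution of the linearly constrained problem: whenever φ : ℕ → ℕ is strictly increasing, u_{φ(k)} converges weakly to ũ in U and v_{φ(k)} converges to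 ṽ in H, then ṽ ∈ C, K ũ + ṽ = Y, and J(ũ) ≤ J(u) for every u ∈ U with Y − K u ∈ C. -/
open RealInnerProductSpace

/-- A quadratic `t ↦ t * a + t ^ 2 * b` that is nonnegative on `(0, 1]` has nonnegative slope at
`0`. -/
theorem nonneg_of_forall_mul_add_sq_mul_nonneg {a b : ℝ}
    (h : ∀ t : ℝ, 0 < t → t ≤ 1 → 0 ≤ t * a + t ^ 2 * b) : 0 ≤ a := by
  by_contra! ha
  have hb : 0 < |b| + 1 := by positivity
  have ht : 0 < min 1 (-a / (2 * (|b| + 1))) :=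
    lt_min one_pos (div_pos (neg_pos.mpr ha) (by positivity))
  set t := min 1 (-a / (2 * (|b| + 1))) with ht_def
  have h1 := h t ht (min_le_left _ _)
  have h2 : t * (2 * (|b| + 1)) ≤ -a := (le_div_iff₀ (by positivity)).mp (min_le_right _ _)
  have h3 : 0 ≤ a + t * b := by
    by_contra! hneg
    nlinarith [mul_pos_of_neg_of_neg (neg_lt_zero.mpr ht) hneg]
  nlinarith [mul_le_mul_of_nonneg_left (le_abs_self b) ht.le]

/-- A closed convex set in a Hilbert space contains the weak limit of any sequence that is
eventually in it. -/
theorem Convex.mem_of_tendsto_inner {U : Type*} [NormedAddCommGroup U] [InnerProductSpace ℝ U]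
    [CompleteSpace U] {S : Set U} (hS : Convex ℝ S) (hS' : IsClosed S) {x : ℕ → U} {a : U}
    (hx : ∀ w : U, Filter.Tendsto (fun k => ⟪w, x k⟫) Filter.atTop (nhds ⟪w, a⟫))
    (hmem : ∀ᶠ k in Filter.atTop, x k ∈ S) : a ∈ S := by
  by_contra ha
  obtain ⟨f, c, hf, hc⟩ := geometric_hahn_banach_closed_point hS hS' ha
  have hlim := hx ((InnerProductSpace.toDual ℝ U).symm f)
  simp only [InnerProductSpace.toDual_symm_apply] at hlim
  exact (le_of_tendsto hlim (hmem.mono fun k hk => (hf _ hk).le)).not_gt hc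

/-- A convex lower semicontinuous function on a Hilbert space is weakly sequentially lower
semicontinuous. -/
theorem ConvexOn.le_of_tendsto_inner {U : Type*} [NormedAddCommGroup U] [InnerProductSpace ℝ U]
    [CompleteSpace U] {J : U → ℝ} (hJ : ConvexOn ℝ Set.univ J) (hJ' : LowerSemicontinuous J)
    {x : ℕ → U} {a : U} {b : ℕ → ℝ} {B : ℝ}
    (hx : ∀ w : U, Filter.Tendsto (fun k => ⟪w, x k⟫) Filter.atTop (nhds ⟪w, a⟫))
    (hb : Filter.Tendsto b Filter.atTop (nhds B))
    (hle : ∀ᶠ k in Filter.atTop, J (x k) ≤ b k) : J a ≤ B := by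
  refine le_of_forall_gt_imp_ge_of_dense fun c hc => ?_
  have hconv : Convex ℝ {w | J w ≤ c} := by simpa using hJ.convex_le c
  refine hconv.mem_of_tendsto_inner (hJ'.isClosed_preimage c) hx ?_
  filter_upwards [hle, hb.eventually (gt_mem_nhds hc)] with k h1 h2
  exact h1.trans h2.le

section SaddlePoint

variable {U H : Type*} [NormedAddCommGroup H] [InnerProductSpace ℝ H]
  [NormedAddCommGroup U] [InnerProductSpace ℝ U]
  {K : U →L[ℝ] H} {J : U → ℝ} {Y : H} {C : Set H} {lam : ℝ} {uhat : U} {vhat phat : H}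

/-- The primal part of a saddle point is feasible. -/
theorem augLag_saddle_feasible
    (h : ∀ p : H, augLag K J Y lam uhat vhat p ≤ augLag K J Y lam uhat vhat phat) :
    K uhat + vhat = Y := by
  have h1 := h (phat - (K uhat + vhat - Y))
  simp only [augLag] at h1
  rw [inner_sub_left, real_inner_self_eq_norm_sq] at h1
  rw [← sub_eq_zero, ← norm_eq_zero]
  exact pow_eq_zero_iff two_ne_zero |>.mp (le_antisymm (by linarith) (sq_nonneg _))

/-- The dual part of a saddle point is a subgradient of `J` at the primal solution. -/
theorem augLag_saddle_subgradient (hJ : ConvexOn ℝ Set.univ J) (hfeas : K uhat + vhat = Y)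
    (hvhat : vhat ∈ C)
    (h : ∀ u : U, ∀ v ∈ C, augLag K J Y lam uhat vhat phat ≤ augLag K J Y lam u v phat) (w : U) :
    0 ≤ J w - J uhat - ⟪phat, K w - K uhat⟫ := by
  refine nonneg_of_forall_mul_add_sq_mul_nonneg
    (b := 1 / (2 * lam) * ‖K w - K uhat‖ ^ 2) fun t ht ht1 => ?_
  have h1 := h ((1 - t) • uhat + t • w) vhat hvhat
  have h2 := hJ.2 (Set.mem_univ uhat) (Set.mem_univ w) (sub_nonneg.mpr ht1) ht.le (by ring)
  have h3 : K ((1 - t) • uhat + t • w) + vhat - Y = t • (K w - K uhat) := by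
    rw [← hfeas]
    simp only [map_add, map_smul]
    module
  simp only [augLag, h3, hfeas, sub_self, norm_zero, inner_zero_right, norm_smul,
    real_inner_smul_right, mul_pow, Real.norm_eq_abs, sq_abs] at h1
  simp only [smul_eq_mul] at h2
  linarith

/-- The dual part of a saddle point is normal to the constraint set. -/
theorem augLag_saddle_normal (hC : Convex ℝ C) (hfeas : K uhat + vhat = Y) (hvhat : vhat ∈ C)
    (h : ∀ u : U, ∀ v ∈ C, augLag K J Y lam uhat vhat phat ≤ augLag K J Y lam u v phat)
    {v : H} (hv : v ∈ C) : ⟪phat, v - vhat⟫ ≤ 0 := by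
  rw [← neg_nonneg]
  refine nonneg_of_forall_mul_add_sq_mul_nonneg
    (b := 1 / (2 * lam) * ‖v - vhat‖ ^ 2) fun t ht ht1 => ?_
  have h1 := h uhat _ (hC hvhat hv (sub_nonneg.mpr ht1) ht.le (by ring))
  have h3 : K uhat + ((1 - t) • vhat + t • v) - Y = t • (v - vhat) := by
    rw [← hfeas]
    module
  simp only [augLag, h3, hfeas, sub_self, norm_zero, inner_zero_right, norm_smul,
    real_inner_smul_right, mul_pow, Real.norm_eq_abs, sq_abs] at h1
  linarith

/-- The primal part of a saddle point solves the constrained problem. -/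
theorem augLag_saddle_le (hfeas : K uhat + vhat = Y)
    (h : ∀ u : U, ∀ v ∈ C, augLag K J Y lam uhat vhat phat ≤ augLag K J Y lam u v phat)
    {w : U} (hw : Y - K w ∈ C) : J uhat ≤ J w := by
  simpa [augLag, hfeas] using h w _ hw

end SaddlePoint

/-- One-step energy decrease of the alternating direction method of multipliers, where `x`, `q` are
the errors of `K u` and of the multiplier, `x'`, `q'` their previous values and `r` the residual. -/
theorem admm_energy_decrease {H : Type*} [NormedAddCommGroup H] [InnerProductSpace ℝ H] {lam : ℝ}
    (hlam : 0 < lam) {x x' q q' r : H} (hq : lam • q' = lam • q + r) (hx : 0 ≤ ⟪q, x⟫)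
    (hy : 0 ≤ ⟪q + (1 / lam) • (x - x'), r - x⟫) (hr : ⟪x - x', r⟫ ≤ 0) :
    ‖lam • q‖ ^ 2 + ‖x‖ ^ 2 + (‖r‖ ^ 2 + ‖x - x'‖ ^ 2) ≤ ‖lam • q'‖ ^ 2 + ‖x'‖ ^ 2 := by
  have hx' : ‖x'‖ ^ 2 = ‖x‖ ^ 2 - 2 * ⟪x - x', x⟫ + ‖x - x'‖ ^ 2 := by
    rw [real_inner_comm, ← norm_sub_sq_real, sub_sub_cancel]
  have hmul : 0 ≤ lam * (⟪q, x⟫ + ⟪q + (1 / lam) • (x - x'), r - x⟫) := by positivity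
  have hexp : lam * (⟪q, x⟫ + ⟪q + (1 / lam) • (x - x'), r - x⟫)
      = lam * ⟪q, r⟫ + (⟪x - x', r⟫ - ⟪x - x', x⟫) := by
    rw [inner_add_left, real_inner_smul_left, inner_sub_right, inner_sub_right]
    field_simp
    ring
  rw [hq, norm_add_sq_real, real_inner_smul_left, hx']
  linarith

/-- If a nonnegative sequence `E` decreases by at least `a n ≥ 0` at step `n`, then `a` is
summable. -/
theorem summable_of_add_le_of_nonneg {E a : ℕ → ℝ} (hE : ∀ n, 0 ≤ E n) (ha : ∀ n, 0 ≤ a n)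
    (h : ∀ n, E (n + 1) + a n ≤ E n) : Summable a := by
  refine summable_of_sum_range_le (c := E 0) ha fun n => ?_
  have hsum : E n + ∑ i ∈ Finset.range n, a i ≤ E 0 := by
    induction n with
    | zero => simp
    | succ n ih =>
      rw [Finset.sum_range_succ]
      linarith [h n]
  linarith [hE n]

/-- The inner product of a norm-bounded sequence with a null sequence tends to zero. -/
theorem tendsto_inner_zero_of_norm_le {H : Type*} [NormedAddCommGroup H] [InnerProductSpace ℝ H]
    {a b : ℕ → H} {M : ℝ} (ha : Filter.Tendsto a Filter.atTop (nhds 0)) (hb : ∀ n, ‖b n‖ ≤ M) :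
    Filter.Tendsto (fun n => ⟪a n, b n⟫) Filter.atTop (nhds 0) := by
  refine squeeze_zero_norm (a := fun n => ‖a n‖ * M) (fun n => ?_)
    (by simpa using ha.norm.mul_const M)
  exact (norm_inner_le_norm _ _).trans (by gcongr; exact hb n)

/-- Convergence of the exact alternating direction method of multipliers
(Theorem 2.2). -/
theorem admm_exact_convergence
    {H U : Type*}
    [NormedAddCommGroup H] [InnerProductSpace ℝ H] [FiniteDimensional ℝ H]
    [NormedAddCommGroup U] [InnerProductSpace ℝ U] [CompleteSpace U]
    (K : U →L[ℝ] H) (J : U → ℝ)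
    (hJconv : ConvexOn ℝ Set.univ J) (hJlsc : LowerSemicontinuous J)
    (Y : H) (C : Set H) (hCne : C.Nonempty) (hCclosed : IsClosed C)
    (hCconv : Convex ℝ C)
    (lam : ℝ) (hlam : 0 < lam)
    -- saddle point of the augmented Lagrangian
    (uhat : U) (vhat phat : H) (hvhatC : vhat ∈ C)
    (hsaddle₁ : ∀ p : H, augLag K J Y lam uhat vhat p ≤ augLag K J Y lam uhat vhat phat)
    (hsaddle₂ : ∀ u : U, ∀ v ∈ C, augLag K J Y lam uhat vhat phat ≤ augLag K J Y lam u v phat)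
    -- coercivity-type assumption
    (hbdd : ∀ a b : ℝ, Bornology.IsBounded {w : U | ‖K w‖ ≤ a ∧ J w ≤ b})
    -- exact ADMM sequence
    (u : ℕ → U) (v p : ℕ → H)
    (hu0 : u 0 = 0) (hv0 : v 0 = 0) (hp0 : p 0 = 0)
    (hstep1 : ∀ k, 1 ≤ k → v k ∈ C ∧ ∀ w ∈ C,
      (1 / lam) * ⟪K (u (k - 1)) + v k - Y - lam • p (k - 1), w - v k⟫ ≥ 0)
    (hstep2 : ∀ k, 1 ≤ k → ∀ w : U,
      J w - J (u k) + (1 / lam) * ⟪K (u k) + v k - Y - lam • p (k - 1), K w - K (u k)⟫ ≥ 0)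
    (hstep3 : ∀ k, 1 ≤ k → p k = p (k - 1) - (1 / lam) • (K (u k) + v k - Y)) :
    -- (a) boundedness of the sequence (u_k, v_k)_{k ≥ 1}
    Bornology.IsBounded (Set.range (fun k : ℕ => (u (k + 1), v (k + 1)))) ∧
    -- (b) square-summability of the residuals
    Summable (fun k : ℕ => ‖K (u (k + 1)) + v (k + 1) - Y‖ ^ 2 +
        ‖K (u (k + 1)) - K (u k)‖ ^ 2) ∧
    -- (c) every weak cluster point solves the constrained problem
    (∀ φ : ℕ → ℕ, StrictMono φ → ∀ (ut : U) (vt : H),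
      (∀ w : U, Filter.Tendsto (fun k : ℕ => ⟪w, u (φ k)⟫) Filter.atTop (nhds ⟪w, ut⟫)) →
      Filter.Tendsto (fun k : ℕ => v (φ k)) Filter.atTop (nhds vt) →
      vt ∈ C ∧ K ut + vt = Y ∧ ∀ w : U, Y - K w ∈ C → J ut ≤ J w) := by
  have hfeas := augLag_saddle_feasible hsaddle₁
  -- optimality conditions in terms of the updated multiplier
  have hres (n : ℕ) : lam • p n = lam • p (n + 1) + (K (u (n + 1)) + v (n + 1) - Y) := by
    rw [hstep3 (n + 1) (by lia), Nat.add_sub_cancel, smul_sub, smul_smul,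
      mul_one_div_cancel hlam.ne', one_smul, sub_add_cancel]
  have hsub (n : ℕ) (w : U) :
      0 ≤ J w - J (u (n + 1)) - ⟪p (n + 1), K w - K (u (n + 1))⟫ := by
    have h := hstep2 (n + 1) (by lia) w
    have hneg : K (u (n + 1)) + v (n + 1) - Y - lam • p n = -(lam • p (n + 1)) := by
      rw [hres]
      abel
    rw [Nat.add_sub_cancel, hneg, inner_neg_left, real_inner_smul_left, mul_neg, ← mul_assoc,
      one_div_mul_cancel hlam.ne', one_mul] at h
    linarith
  have hvC (n : ℕ) : v (n + 1) ∈ C := (hstep1 (n + 1) (by lia)).1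
  have hnormal (n : ℕ) : 0 ≤ ⟪p (n + 1) + (1 / lam) • (K (u (n + 1)) - K (u n)),
      v (n + 1) - vhat⟫ := by
    have h := (hstep1 (n + 1) (by lia)).2 vhat hvhatC
    have hneg : K (u n) + v (n + 1) - Y - lam • p n
        = -(lam • (p (n + 1) + (1 / lam) • (K (u (n + 1)) - K (u n)))) := by
      rw [hres, smul_add, smul_smul, mul_one_div_cancel hlam.ne', one_smul]
      abel
    rw [Nat.add_sub_cancel, hneg, ← neg_sub (v (n + 1)) vhat, inner_neg_neg,
      real_inner_smul_left, ← mul_assoc, one_div_mul_cancel hlam.ne', one_mul] at h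
    exact h
  have hmono (n : ℕ) : 0 ≤ ⟪p (n + 1) - phat, K (u (n + 1)) - K uhat⟫ := by
    have h1 := hsub n uhat
    have h2 := augLag_saddle_subgradient hJconv hfeas hvhatC hsaddle₂ (u (n + 1))
    rw [← neg_sub (K (u (n + 1))), inner_neg_right] at h1
    rw [inner_sub_left]
    linarith
  have hmono' (n : ℕ) : ⟪K (u (n + 2)) - K (u (n + 1)), K (u (n + 2)) + v (n + 2) - Y⟫ ≤ 0 := by
    have h1 := hsub n (u (n + 2))
    have h2 := hsub (n + 1) (u (n + 1))
    rw [← neg_sub (K (u (n + 2))), inner_neg_right] at h2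
    rw [← sub_eq_iff_eq_add'.mpr (hres (n + 1)), ← smul_sub, real_inner_smul_right,
      real_inner_comm, inner_sub_left]
    exact mul_nonpos_of_nonneg_of_nonpos hlam.le (by linarith)
  have hsplit (n : ℕ) : v (n + 1) - vhat
      = (K (u (n + 1)) + v (n + 1) - Y) - (K (u (n + 1)) - K uhat) := by
    rw [← hfeas]
    abel
  set E : ℕ → ℝ := fun n => ‖lam • (p (n + 1) - phat)‖ ^ 2 + ‖K (u (n + 1)) - K uhat‖ ^ 2 with hE
  have hdecr (n : ℕ) : E (n + 1) + (‖K (u (n + 2)) + v (n + 2) - Y‖ ^ 2 +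
      ‖K (u (n + 2)) - K (u (n + 1))‖ ^ 2) ≤ E n := by
    have hd : K (u (n + 2)) - K uhat - (K (u (n + 1)) - K uhat)
        = K (u (n + 2)) - K (u (n + 1)) := by abel
    have h := admm_energy_decrease hlam (x := K (u (n + 2)) - K uhat)
      (x' := K (u (n + 1)) - K uhat) (q := p (n + 2) - phat) (q' := p (n + 1) - phat)
      (r := K (u (n + 2)) + v (n + 2) - Y)
      (by rw [smul_sub, hres (n + 1), smul_sub]; abel) (hmono (n + 1))
      (by
        have h1 := hnormal (n + 1)
        have h2 := augLag_saddle_normal hCconv hfeas hvhatC hsaddle₂ (hvC (n + 1))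
        rw [hd, ← hsplit (n + 1), sub_add_eq_add_sub, inner_sub_left]
        linarith)
      (by rw [hd]; exact hmono' n)
    rwa [hd] at h
  have hsum : Summable (fun k : ℕ => ‖K (u (k + 1)) + v (k + 1) - Y‖ ^ 2 +
      ‖K (u (k + 1)) - K (u k)‖ ^ 2) :=
    (summable_nat_add_iff 1).mp <| summable_of_add_le_of_nonneg (E := E)
      (fun n => by positivity) (fun n => by positivity) hdecr
  -- the residuals tend to zero
  have hnull {a : ℕ → H} (hle : ∀ n, ‖a n‖ ^ 2 ≤ ‖K (u (n + 1)) + v (n + 1) - Y‖ ^ 2 +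
      ‖K (u (n + 1)) - K (u n)‖ ^ 2) : Filter.Tendsto a Filter.atTop (nhds 0) := by
    have h := (squeeze_zero (fun n => by positivity) hle hsum.tendsto_atTop_zero).sqrt
    simp only [Real.sqrt_sq (norm_nonneg _), Real.sqrt_zero] at h
    exact tendsto_zero_iff_norm_tendsto_zero.mpr h
  have hr := hnull (a := fun n => K (u (n + 1)) + v (n + 1) - Y)
    fun n => le_add_of_nonneg_right (by positivity)
  have hd := hnull (a := fun n => K (u (n + 1)) - K (u n))
    fun n => le_add_of_nonneg_left (by positivity)
  -- the energy bounds the iterates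
  have hEanti : Antitone E := antitone_nat_of_succ_le fun n =>
    (le_add_of_nonneg_right (by positivity)).trans (hdecr n)
  have hx (n : ℕ) : ‖K (u (n + 1)) - K uhat‖ ≤ √(E 0) :=
    Real.le_sqrt_of_sq_le <| (le_add_of_nonneg_left (by positivity)).trans (hEanti n.zero_le)
  have hq (n : ℕ) : ‖lam • (p (n + 1) - phat)‖ ≤ √(E 0) :=
    Real.le_sqrt_of_sq_le <| (le_add_of_nonneg_right (by positivity)).trans (hEanti n.zero_le)
  have hp (n : ℕ) : ‖p (n + 1)‖ ≤ √(E 0) / lam + ‖phat‖ := by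
    have h := hq n
    rw [norm_smul, Real.norm_of_nonneg hlam.le, ← le_div_iff₀' hlam] at h
    linarith [norm_le_norm_sub_add (p (n + 1)) phat]
  obtain ⟨R, hR⟩ := (Metric.isBounded_range_of_tendsto _ hr).exists_norm_le
  have hy (n : ℕ) : ‖v (n + 1) - vhat‖ ≤ R + √(E 0) := by
    rw [hsplit]
    exact (norm_sub_le _ _).trans (add_le_add (hR _ ⟨n, rfl⟩) (hx n))
  have hJu (n : ℕ) : J (u (n + 1)) ≤ J uhat + ⟪p (n + 1), K (u (n + 1)) - K uhat⟫ := by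
    have h := hsub n uhat
    rw [← neg_sub (K (u (n + 1))), inner_neg_right] at h
    linarith
  refine ⟨?_, hsum, ?_⟩
  · have hu : Bornology.IsBounded (Set.range fun k => u (k + 1)) := by
      refine (hbdd (√(E 0) + ‖K uhat‖)
        (J uhat + (√(E 0) / lam + ‖phat‖) * √(E 0))).subset ?_
      rintro _ ⟨n, rfl⟩
      refine ⟨by linarith [norm_le_norm_sub_add (K (u (n + 1))) (K uhat), hx n], ?_⟩
      refine (hJu n).trans (by
        gcongr
        exact (real_inner_le_norm _ _).trans
          (mul_le_mul (hp n) (hx n) (norm_nonneg _) (by positivity)))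
    have hv : Bornology.IsBounded (Set.range fun k => v (k + 1)) := by
      refine isBounded_iff_forall_norm_le.mpr ⟨R + √(E 0) + ‖vhat‖, ?_⟩
      rintro _ ⟨n, rfl⟩
      linarith [norm_le_norm_sub_add (v (n + 1)) vhat, hy n]
    refine (hu.prod hv).subset ?_
    rintro _ ⟨n, rfl⟩
    exact ⟨⟨n, rfl⟩, ⟨n, rfl⟩⟩
  · intro φ hφ ut vt hut hvt
    have : CompleteSpace H := FiniteDimensional.complete ℝ H
    -- shift the subsequence so that it avoids the index `0`
    obtain ⟨ψ, hψ⟩ : ∃ ψ : ℕ → ℕ, ∀ k, φ (k + 1) = ψ k + 1 :=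
      ⟨fun k => φ (k + 1) - 1, fun k => by have := hφ.le_apply (x := k + 1); lia⟩
    have hψlim : Filter.Tendsto ψ Filter.atTop Filter.atTop :=
      Filter.tendsto_atTop_mono (fun k => by have := hφ.le_apply (x := k + 1); grind)
        Filter.tendsto_id
    replace hut (w : U) :
        Filter.Tendsto (fun k => ⟪w, u (ψ k + 1)⟫) Filter.atTop (nhds ⟪w, ut⟫) := by
      simpa only [hψ] using (Filter.tendsto_add_atTop_iff_nat 1).mpr (hut w)
    replace hvt : Filter.Tendsto (fun k => v (ψ k + 1)) Filter.atTop (nhds vt) := by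
      simpa only [hψ] using (Filter.tendsto_add_atTop_iff_nat 1).mpr hvt
    refine ⟨hCclosed.mem_of_tendsto hvt (.of_forall fun k => hvC _), ?_, fun w hw => ?_⟩
    · have hlim (h : H) : ⟪h, K ut + vt - Y⟫ = 0 := by
        have h1 := hut (K.adjoint h)
        simp only [ContinuousLinearMap.adjoint_inner_left] at h1
        have h2 := (h1.add ((tendsto_const_nhds (x := h)).inner (𝕜 := ℝ) hvt)).sub_const ⟪h, Y⟫
        have h3 := (tendsto_const_nhds (x := h)).inner (𝕜 := ℝ) (hr.comp hψlim)
        simp only [← inner_add_right, ← inner_sub_right] at h2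
        rw [inner_zero_right] at h3
        exact tendsto_nhds_unique h2 h3
      exact sub_eq_zero.mp (inner_self_eq_zero.mp (hlim _))
    · refine le_trans ?_ (augLag_saddle_le hfeas hsaddle₂ hw)
      have hlim : Filter.Tendsto (fun n => J uhat + (⟪K (u (n + 1)) + v (n + 1) - Y, p (n + 1)⟫
          + 1 / lam * ⟪K (u (n + 1)) - K (u n), v (n + 1) - vhat⟫))
          Filter.atTop (nhds (J uhat)) := by
        simpa using ((tendsto_inner_zero_of_norm_le hr hp).add
          ((tendsto_inner_zero_of_norm_le hd hy).const_mul (1 / lam))).const_add (J uhat)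
      refine hJconv.le_of_tendsto_inner hJlsc hut (hlim.comp hψlim) (.of_forall fun k => ?_)
      have h1 := hnormal (ψ k)
      rw [inner_add_left, real_inner_smul_left] at h1
      have h2 := hJu (ψ k)
      have h3 := congrArg (fun y => ⟪p (ψ k + 1), y⟫) (hsplit (ψ k))
      simp only [inner_sub_right _ _ (K (u (ψ k + 1)) - K uhat)] at h3
      simp only [Function.comp_apply]
      rw [real_inner_comm]
      linarith
end

section
/- A priori error bound at termination of exact ADMM (Theorem 2.3): under the stated setting, let (û, v̂, p̂) be any saddle point of L_λ and let (u_k, v_k, p_k)_{k≥0} be an exact ADMM sequence. Let τ > 0 and let k ≥ 1 be an index with ‖K u_k + v_k − Y‖ ≤ τ and ‖K(u_k − u_{k−1})‖ ≤ τ. Then 0 ≤ J(u_k) − J(û) − ⟨K*p̂, u_k − û⟩_U ≤ τ·(6‖p̂‖ + (4‖K û‖ + 2τ)/λ). -/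
open RealInnerProductSpace

/-- A nonnegative perturbation of first order in `t` cannot compensate a negative constant. -/
theorem nonneg_of_forall_nonneg_mul_add {c x : ℝ} (hc : 0 ≤ c)
    (h : ∀ t : ℝ, 0 < t → t ≤ 1 → 0 ≤ t * c + x) : 0 ≤ x := by
  by_contra! hx
  have hd : 0 < c - x := by linarith
  have h1 := h (-x / (c - x)) (div_pos (by linarith) hd) ((div_le_one hd).2 (by linarith))
  have h2 : -x / (c - x) * c + x = -(x ^ 2 / (c - x)) := by
    field_simp
    ring
  have h3 : 0 < x ^ 2 / (c - x) := div_pos (by nlinarith) hd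
  linarith

section SaddlePoint

variable {H U : Type*}
  [NormedAddCommGroup H] [InnerProductSpace ℝ H]
  [NormedAddCommGroup U] [InnerProductSpace ℝ U]
  {K : U →L[ℝ] H} {J : U → ℝ} {Y : H} {C : Set H} {lam : ℝ} {uhat : U} {vhat phat : H}

/-- Maximality in the multiplier forces the constraint to hold. -/
theorem augLag_feasible_of_forall_le
    (h : ∀ p : H, augLag K J Y lam uhat vhat p ≤ augLag K J Y lam uhat vhat phat) :
    K uhat + vhat - Y = 0 := by
  have h1 := h (phat - (K uhat + vhat - Y))
  simp only [augLag] at h1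
  have h2 : ‖K uhat + vhat - Y‖ ^ 2 ≤ 0 := by
    rw [inner_sub_left, real_inner_self_eq_norm_sq] at h1
    linarith
  exact norm_eq_zero.1 (pow_eq_zero_iff two_ne_zero |>.1 (le_antisymm h2 (sq_nonneg _)))

/-- At a feasible minimizer, the generalized Bregman distance of `J` is nonnegative. -/
theorem augLag_bregman_nonneg (hJ : ConvexOn ℝ Set.univ J) (hlam : 0 < lam)
    (hfeas : K uhat + vhat - Y = 0)
    (h : ∀ u : U, augLag K J Y lam uhat vhat phat ≤ augLag K J Y lam u vhat phat) (u : U) :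
    0 ≤ J u - J uhat - ⟪phat, K u - K uhat⟫ := by
  refine nonneg_of_forall_nonneg_mul_add
    (c := 1 / (2 * lam) * ‖K u - K uhat‖ ^ 2) (by positivity) fun t ht ht1 => ?_
  have h1 := h ((1 - t) • uhat + t • u)
  have h2 := hJ.2 (Set.mem_univ uhat) (Set.mem_univ u) (sub_nonneg.2 ht1) ht.le (by ring)
  have h3 : K ((1 - t) • uhat + t • u) + vhat - Y = t • (K u - K uhat) := by
    rw [← sub_zero (K ((1 - t) • uhat + t • u) + vhat - Y), ← hfeas, map_add, map_smul, map_smul]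
    module
  simp only [augLag, hfeas, h3, norm_zero, inner_zero_right, inner_smul_right, norm_smul,
    Real.norm_eq_abs, mul_pow, sq_abs] at h1
  simp only [smul_eq_mul] at h2
  refine le_of_mul_le_mul_left ?_ ht
  linarith

/-- At a feasible minimizer, the multiplier lies in the normal cone of `C`. -/
theorem augLag_inner_sub_nonpos (hC : Convex ℝ C) (hlam : 0 < lam) (hv : vhat ∈ C)
    (hfeas : K uhat + vhat - Y = 0)
    (h : ∀ v ∈ C, augLag K J Y lam uhat vhat phat ≤ augLag K J Y lam uhat v phat)
    {w : H} (hw : w ∈ C) : ⟪phat, w - vhat⟫ ≤ 0 := by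
  rw [← neg_nonneg]
  refine nonneg_of_forall_nonneg_mul_add
    (c := 1 / (2 * lam) * ‖w - vhat‖ ^ 2) (by positivity) fun t ht ht1 => ?_
  have h1 := h ((1 - t) • vhat + t • w) (hC hv hw (sub_nonneg.2 ht1) ht.le (by ring))
  have h3 : K uhat + ((1 - t) • vhat + t • w) - Y = t • (w - vhat) := by
    rw [← sub_zero (K uhat + ((1 - t) • vhat + t • w) - Y), ← hfeas]
    module
  simp only [augLag, hfeas, h3, norm_zero, inner_zero_right, inner_smul_right, norm_smul,
    Real.norm_eq_abs, mul_pow, sq_abs] at h1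
  refine le_of_mul_le_mul_left ?_ ht
  linarith

end SaddlePoint

/-- Monotonicity of the ADMM energy: here `q`, `q'` are the new and old multiplier errors,
`a`, `a'` the new and old primal errors, and `r` the new residual. -/
theorem admm_energy_le {H : Type*} [NormedAddCommGroup H] [InnerProductSpace ℝ H] {lam : ℝ}
    {a a' q q' r : H} (hq : lam • q' = lam • q + r)
    (h : 0 ≤ lam * ⟪q, r⟫ + ⟪a - a', r - a⟫) :
    lam ^ 2 * ‖q‖ ^ 2 + ‖a‖ ^ 2 ≤ lam ^ 2 * ‖q'‖ ^ 2 + ‖a'‖ ^ 2 := by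
  have h1 : lam ^ 2 * ‖q'‖ ^ 2 = lam ^ 2 * ‖q‖ ^ 2 + 2 * (lam * ⟪q, r⟫) + ‖r‖ ^ 2 := by
    have h2 := norm_add_sq_real (lam • q) r
    rw [← hq] at h2
    simpa only [norm_smul, Real.norm_eq_abs, mul_pow, sq_abs, real_inner_smul_left] using h2
  have h2 : 0 ≤ ‖a - a' - r‖ ^ 2 := sq_nonneg _
  have h3 := norm_sub_sq_real (a - a') r
  have h4 := norm_sub_sq_real a (a - a')
  rw [sub_sub_cancel, real_inner_comm] at h4
  rw [inner_sub_right] at h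
  linarith

/-- A priori error bound at termination of exact ADMM (Theorem 2.3). -/
theorem admm_exact_error_bound
    {H U : Type*}
    [NormedAddCommGroup H] [InnerProductSpace ℝ H] [FiniteDimensional ℝ H]
    [NormedAddCommGroup U] [InnerProductSpace ℝ U] [CompleteSpace U]
    (K : U →L[ℝ] H) (J : U → ℝ)
    (hJconv : ConvexOn ℝ Set.univ J) (hJlsc : LowerSemicontinuous J)
    (Y : H) (C : Set H) (hCne : C.Nonempty) (hCclosed : IsClosed C)
    (hCconv : Convex ℝ C)
    (lam : ℝ) (hlam : 0 < lam)
    -- saddle point of the augmented Lagrangian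
    (uhat : U) (vhat phat : H) (hvhatC : vhat ∈ C)
    (hsaddle₁ : ∀ p : H, augLag K J Y lam uhat vhat p ≤ augLag K J Y lam uhat vhat phat)
    (hsaddle₂ : ∀ u : U, ∀ v ∈ C, augLag K J Y lam uhat vhat phat ≤ augLag K J Y lam u v phat)
    -- exact ADMM sequence
    (u : ℕ → U) (v p : ℕ → H)
    (hu0 : u 0 = 0) (hv0 : v 0 = 0) (hp0 : p 0 = 0)
    (hstep1 : ∀ k, 1 ≤ k → v k ∈ C ∧ ∀ w ∈ C,
      (1 / lam) * ⟪K (u (k - 1)) + v k - Y - lam • p (k - 1), w - v k⟫ ≥ 0)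
    (hstep2 : ∀ k, 1 ≤ k → ∀ w : U,
      J w - J (u k) + (1 / lam) * ⟪K (u k) + v k - Y - lam • p (k - 1), K w - K (u k)⟫ ≥ 0)
    (hstep3 : ∀ k, 1 ≤ k → p k = p (k - 1) - (1 / lam) • (K (u k) + v k - Y))
    -- stopping index
    (τ : ℝ) (hτ : 0 < τ) (k : ℕ) (hk : 1 ≤ k)
    (hres1 : ‖K (u k) + v k - Y‖ ≤ τ)
    (hres2 : ‖K (u k) - K (u (k - 1))‖ ≤ τ) :
    0 ≤ J (u k) - J uhat - ⟪(ContinuousLinearMap.adjoint K) phat, u k - uhat⟫ ∧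
    J (u k) - J uhat - ⟪(ContinuousLinearMap.adjoint K) phat, u k - uhat⟫ ≤
      τ * (6 * ‖phat‖ + (4 * ‖K uhat‖ + 2 * τ) / lam) := by
  have hfeas := augLag_feasible_of_forall_le hsaddle₁
  have hbreg := augLag_bregman_nonneg hJconv hlam hfeas fun w => hsaddle₂ w vhat hvhatC
  have hcone : ∀ w ∈ C, ⟪phat, w - vhat⟫ ≤ 0 := fun w hw =>
    augLag_inner_sub_nonpos hCconv hlam hvhatC hfeas (hsaddle₂ uhat) hw
  have hne := hlam.ne'
  have hres : ∀ n, K (u n) + v n - Y = K (u n) - K uhat + (v n - vhat) := fun n => by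
    rw [← sub_zero (K (u n) + v n - Y), ← hfeas]
    abel
  have hmult : ∀ n, 1 ≤ n → lam • p (n - 1) = lam • p n + (K (u n) + v n - Y) := fun n hn => by
    rw [hstep3 n hn, smul_sub, smul_smul, mul_one_div_cancel hne, one_smul, sub_add_cancel]
  have hub : ∀ n, 1 ≤ n → J (u n) - J uhat - ⟪phat, K (u n) - K uhat⟫
      ≤ ⟪p n - phat, K (u n) - K uhat⟫ := fun n hn => by
    have h := hstep2 n hn uhat
    rw [hmult n hn, sub_add_cancel_right, ← neg_sub (K (u n)), inner_neg_neg,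
      real_inner_smul_left, ← mul_assoc, one_div_mul_cancel hne, one_mul] at h
    rw [inner_sub_left]
    linarith
  have hvub : ∀ n, 1 ≤ n → 0 ≤ lam * ⟪p n - phat, v n - vhat⟫
      + ⟪K (u n) - K (u (n - 1)), v n - vhat⟫ := fun n hn => by
    obtain ⟨hvC, h⟩ := hstep1 n hn
    have h1 := nonneg_of_mul_nonneg_right (h vhat hvhatC) (one_div_pos.2 hlam)
    have h2 : K (u (n - 1)) + v n - Y - lam • p (n - 1)
        = -(lam • p n + (K (u n) - K (u (n - 1)))) := by
      rw [hmult n hn]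
      abel
    rw [h2, ← neg_sub (v n), inner_neg_neg, inner_add_left, real_inner_smul_left] at h1
    have h3 := mul_nonneg hlam.le (neg_nonneg.2 (hcone _ hvC))
    rw [inner_sub_left]
    linarith
  have henergy : ∀ n, lam ^ 2 * ‖p n - phat‖ ^ 2 + ‖K (u n) - K uhat‖ ^ 2
      ≤ lam ^ 2 * ‖phat‖ ^ 2 + ‖K uhat‖ ^ 2 := by
    intro n
    induction n with
    | zero => simp [hp0, hu0]
    | succ n ih =>
      refine (admm_energy_le (r := K (u (n + 1)) + v (n + 1) - Y) ?_ ?_).trans ih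
      · have h := hmult (n + 1) (by simp)
        rw [add_tsub_cancel_right] at h
        rw [smul_sub, smul_sub, h]
        abel
      · have h1 := mul_nonneg hlam.le ((hbreg (u (n + 1))).trans (hub (n + 1) (by simp)))
        have h2 := hvub (n + 1) (by simp)
        rw [add_tsub_cancel_right] at h2
        rw [hres, add_sub_cancel_left, sub_sub_sub_cancel_right, inner_add_right]
        linarith
  rw [ContinuousLinearMap.adjoint_inner_left, map_sub]
  refine ⟨hbreg (u k), ?_⟩
  have hM : 0 ≤ lam * ‖phat‖ + ‖K uhat‖ := by positivity
  have hcross : 0 ≤ lam * ‖phat‖ * ‖K uhat‖ := by positivity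
  have hq : lam * ‖p k - phat‖ ≤ lam * ‖phat‖ + ‖K uhat‖ :=
    (pow_le_pow_iff_left₀ (by positivity) hM two_ne_zero).1 (by nlinarith [henergy k, sq_nonneg ‖K (u k) - K uhat‖])
  have ha : ‖K (u k) - K uhat‖ ≤ lam * ‖phat‖ + ‖K uhat‖ :=
    (pow_le_pow_iff_left₀ (by positivity) hM two_ne_zero).1 (by nlinarith [henergy k, sq_nonneg (lam * ‖p k - phat‖)])
  have hb : ‖v k - vhat‖ ≤ τ + (lam * ‖phat‖ + ‖K uhat‖) := by
    have h : v k - vhat = K (u k) + v k - Y - (K (u k) - K uhat) := by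
      rw [hres, add_sub_cancel_left]
    rw [h]
    exact (norm_sub_le _ _).trans (add_le_add hres1 ha)
  have h1 := (real_inner_le_norm (p k - phat) (K (u k) + v k - Y)).trans
    (mul_le_mul_of_nonneg_left hres1 (norm_nonneg _))
  have h2 := (real_inner_le_norm (K (u k) - K (u (k - 1))) (v k - vhat)).trans
    (mul_le_mul hres2 hb (norm_nonneg _) hτ.le)
  have h3 := hvub k hk
  rw [hres, inner_add_right] at h1
  have h4 := mul_le_mul_of_nonneg_left h1 hlam.le
  have h5 := mul_le_mul_of_nonneg_right hq hτ.le
  have h6 := mul_le_mul_of_nonneg_left (hub k hk) hlam.le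
  have h7 : lam * (τ * (6 * ‖phat‖ + (4 * ‖K uhat‖ + 2 * τ) / lam))
      = τ * (6 * (lam * ‖phat‖) + (4 * ‖K uhat‖ + 2 * τ)) := by
    field_simp
  refine le_of_mul_le_mul_left ?_ hlam
  rw [h7]
  have h8 : 0 ≤ τ * (lam * ‖phat‖) := by positivity
  have h9 : 0 ≤ τ * ‖K uhat‖ := by positivity
  nlinarith
end

section
/- Geometric convergence of Dykstra's cyclic projection algorithm for polyhedra (Theorem 2.5): let E be a finite-dimensional real inner product space and let D₁, …, D_M ⊆ E be nonempty polyhedra, i.e. each D_j is a finite intersection of closed half-spaces {x ∈ E : ⟨a, x⟩ ≤ b}, with D = D₁ ∩ … ∩ D_M nonempty. For each j let P_j : E → E be the metric projection onto D_j, characterized by P_j(x) ∈ D_j and ‖P_j(x) − x‖ ≤ ‖y − x‖ for all y ∈ D_j. Given h ∈ E, define Dykstra iterates by h_{0,0} = h, Q_{−1,j} = 0 for all j, and for all k ≥ 0 and j = 1, …, M: h_{k,j} = P_j(h_{k,j−1} − Q_{k−1,j}), Q_{k,j} = h_{k,j} − (h_{k,j−1} − Q_{k−1,j}), and h_{k+1,0}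 = h_{k,M}. Let h* be the metric projection of h onto D (h* ∈ D and ‖h* − h‖ ≤ ‖y − h‖ for all y ∈ D). Then there exist ρ > 0 and c with 0 ≤ c < 1 such that ‖h_{k,0} − h*‖ ≤ ρ·cᵏ for all k ≥ 0; in particular the Dykstra iterates converge to the projection of h onto the intersection D. -/
open RealInnerProductSpace Filter Topology

/-- If the squares of a nonnegative sequence have bounded partial sums, then the product of a term
with the partial sum up to it is arbitrarily small arbitrarily far out. -/
theorem exists_mul_sum_range_lt {δ : ℕ → ℝ} {B : ℝ}
    (hB : ∀ n, ∑ k ∈ Finset.range n, δ k ^ 2 ≤ B) {ε : ℝ} (hε : 0 < ε) (N : ℕ) :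
    ∃ k ≥ N, δ k * ∑ m ∈ Finset.range (k + 1), δ m < ε := by
  by_contra! hcon
  have hsum : Summable fun k => δ k ^ 2 := summable_of_sum_range_le (fun k => sq_nonneg _) hB
  have hB0 : 0 ≤ B := by simpa using hB 0
  have key : ∀ k ≥ N, ε ^ 2 * (1 / ((k : ℝ) + 1)) ≤ B * δ k ^ 2 := by
    intro k hk
    have h1 := hcon k hk
    have h2 : (∑ m ∈ Finset.range (k + 1), δ m) ^ 2 ≤ ((k : ℝ) + 1) * B := by
      have h3 := sq_sum_le_card_mul_sum_sq (s := Finset.range (k + 1)) (f := δ)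
      rw [Finset.card_range] at h3
      push_cast at h3
      exact h3.trans (mul_le_mul_of_nonneg_left (hB _) (by positivity))
    have h4 : ε ^ 2 ≤ (δ k * ∑ m ∈ Finset.range (k + 1), δ m) ^ 2 :=
      pow_le_pow_left₀ hε.le h1 2
    rw [mul_one_div, div_le_iff₀ (by positivity)]
    calc ε ^ 2 ≤ δ k ^ 2 * (∑ m ∈ Finset.range (k + 1), δ m) ^ 2 := by rw [← mul_pow]; exact h4
      _ ≤ δ k ^ 2 * (((k : ℝ) + 1) * B) := mul_le_mul_of_nonneg_left h2 (sq_nonneg _)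
      _ = B * δ k ^ 2 * ((k : ℝ) + 1) := by ring
  have hs1 : Summable fun k : ℕ => ε ^ 2 * (1 / (((k + N : ℕ) : ℝ) + 1)) :=
    Summable.of_nonneg_of_le (fun k => by positivity) (fun k => key (k + N) (by omega))
      ((summable_nat_add_iff N).2 (hsum.mul_left B))
  have hs2 : Summable fun k : ℕ => ε ^ 2 * (1 / ((k : ℝ) + 1)) :=
    (summable_nat_add_iff (f := fun k : ℕ => ε ^ 2 * (1 / ((k : ℝ) + 1))) N).1 hs1
  have hs3 : Summable fun k : ℕ => 1 / ((k : ℝ) + 1) :=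
    (summable_mul_left_iff (pow_ne_zero 2 hε.ne')).1 hs2
  refine Real.not_summable_one_div_natCast ((summable_nat_add_iff 1).1 ?_)
  exact_mod_cast hs3

/-- A sequence satisfying `u (k + 1) ≤ r * u k` from some index on decays geometrically. -/
theorem exists_le_mul_pow_of_eventually_le {u : ℕ → ℝ} {r : ℝ} (hr : 0 < r)
    (hu : ∀ᶠ k in atTop, u (k + 1) ≤ r * u k) (hanti : Antitone u) (hr1 : r < 1)
    (hu0 : 0 ≤ u 0) :
    ∃ C, 0 < C ∧ ∀ k, u k ≤ C * r ^ k := by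
  obtain ⟨K, hK⟩ := eventually_atTop.1 hu
  have hC : 0 ≤ u 0 * (r ^ K)⁻¹ := by positivity
  refine ⟨u 0 * (r ^ K)⁻¹ + 1, by positivity, fun k => ?_⟩
  suffices h : u k ≤ u 0 * (r ^ K)⁻¹ * r ^ k by
    have : 0 < r ^ k := by positivity
    linarith
  rcases le_total k K with hk | hk
  · have h1 : r ^ K ≤ r ^ k := pow_le_pow_of_le_one hr.le hr1.le hk
    calc u k ≤ u 0 := hanti (Nat.zero_le k)
      _ = u 0 * (r ^ K)⁻¹ * r ^ K := by field_simp
      _ ≤ _ := mul_le_mul_of_nonneg_left h1 hC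
  · induction k, hk using Nat.le_induction with
    | base =>
      calc u K ≤ u 0 := hanti (Nat.zero_le K)
        _ = u 0 * (r ^ K)⁻¹ * r ^ K := by field_simp
    | succ k hk ih =>
      calc u (k + 1) ≤ r * u k := hK k hk
        _ ≤ r * (u 0 * (r ^ K)⁻¹ * r ^ k) := mul_le_mul_of_nonneg_left ih hr.le
        _ = _ := by ring

section InnerProduct

variable {E : Type*} [NormedAddCommGroup E] [InnerProductSpace ℝ E]

/-- The variational inequality for a nearest point of a convex set. -/
theorem inner_sub_nonneg_of_forall_norm_le {K : Set E} (hK : Convex ℝ K) {x p : E} (hp : p ∈ K)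
    (hmin : ∀ y ∈ K, ‖p - x‖ ≤ ‖y - x‖) {y : E} (hy : y ∈ K) : 0 ≤ ⟪p - x, y - p⟫ := by
  have hne : Nonempty K := ⟨⟨p, hp⟩⟩
  have h := (norm_eq_iInf_iff_real_inner_le_zero hK (u := x) hp).1 (le_antisymm
    (le_ciInf fun w => by
      rw [norm_sub_rev x p, norm_sub_rev x]
      exact hmin w w.2)
    (ciInf_le ⟨0, Set.forall_mem_range.2 fun _ => norm_nonneg _⟩ (⟨p, hp⟩ : K))) y hy
  rw [← neg_sub p x, inner_neg_left] at h
  linarith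

theorem convex_setOf_forall_inner_le {ι : Type*} (a : ι → E) (b : ι → ℝ) :
    Convex ℝ {x : E | ∀ i, ⟪a i, x⟫ ≤ b i} := by
  rw [Set.ofPred_forall]
  exact convex_iInter fun i => convex_halfSpace_le (innerSL ℝ (a i)).isBoundedLinearMap.toIsLinearMap _

theorem isClosed_setOf_forall_inner_le {ι : Type*} (a : ι → E) (b : ι → ℝ) :
    IsClosed {x : E | ∀ i, ⟪a i, x⟫ ≤ b i} := by
  rw [Set.ofPred_forall]
  exact isClosed_iInter fun i => isClosed_le (by fun_prop) continuous_const

/-- Constraints that are inactive at a point remain inactive nearby. -/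
theorem eventually_forall_inner_eq_imp {ι : Type*} [Finite ι] {a : ι → E} {b : ι → ℝ} {c : E}
    (hc : ∀ i, ⟪a i, c⟫ ≤ b i) :
    ∀ᶠ w in 𝓝 c, ∀ i, ⟪a i, w⟫ = b i → ⟪a i, c⟫ = b i := by
  rw [eventually_all]
  intro i
  rcases (hc i).eq_or_lt with h | h
  · exact Eventually.of_forall fun _ _ => h
  · have hcont : Tendsto (fun w => ⟪a i, w⟫) (𝓝 c) (𝓝 ⟪a i, c⟫) := by
      have : Continuous fun w => ⟪a i, w⟫ := by fun_prop
      exact this.tendsto c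
    filter_upwards [hcont.eventually (eventually_lt_nhds h)] with w hw h'
    exact absurd h' hw.ne

/-- Normal vectors of a polyhedron at a point lie in the span of the normals of the constraints
that are active there. -/
theorem mem_span_active_of_inner_nonneg [FiniteDimensional ℝ E] {ι : Type*} [Finite ι]
    {a : ι → E} {b : ι → ℝ} {w z : E} (hw : ∀ i, ⟪a i, w⟫ ≤ b i)
    (hz : ∀ y, (∀ i, ⟪a i, y⟫ ≤ b i) → 0 ≤ ⟪z, y - w⟫) :
    z ∈ Submodule.span ℝ {v | ∃ i, v = a i ∧ ⟪a i, w⟫ = b i} := by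
  set V := Submodule.span ℝ {v | ∃ i, v = a i ∧ ⟪a i, w⟫ = b i} with hV
  have key : ∀ u ∈ Vᗮ, 0 ≤ ⟪z, u⟫ := by
    intro u hu
    have hev : ∀ᶠ t : ℝ in 𝓝[>] 0, ∀ i, ⟪a i, w + t • u⟫ ≤ b i := by
      rw [eventually_all]
      intro i
      rcases (hw i).eq_or_lt with h | h
      · have hu0 : ⟪a i, u⟫ = 0 := hu _ (Submodule.subset_span ⟨i, rfl, h⟩)
        refine Eventually.of_forall fun t => ?_
        rw [inner_add_right, inner_smul_right, hu0, h]
        simp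
      · have hcont : Continuous fun t : ℝ => ⟪a i, w + t • u⟫ := by fun_prop
        have ht := hcont.tendsto 0
        simp only [zero_smul, add_zero] at ht
        exact ((ht.eventually (eventually_lt_nhds h)).filter_mono nhdsWithin_le_nhds).mono
          fun t ht => ht.le
    obtain ⟨t, ht, ht0⟩ := (hev.and self_mem_nhdsWithin).exists
    have h1 := hz _ ht
    rw [add_sub_cancel_left, inner_smul_right] at h1
    exact nonneg_of_mul_nonneg_right h1 ht0
  rw [← Submodule.orthogonal_orthogonal V]
  intro u hu
  have h1 := key u hu
  have h2 := key (-u) (Vᗮ.neg_mem hu)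
  rw [inner_neg_right] at h2
  rw [real_inner_comm]
  linarith

/-- A vector in the span of finitely many vectors is controlled by its inner products with
them. -/
theorem exists_norm_le_of_mem_span [FiniteDimensional ℝ E] {S : Set E} (hS : S.Finite) :
    ∃ C : ℝ, ∀ u ∈ Submodule.span ℝ S, ∀ δ : ℝ, 0 ≤ δ →
      (∀ v ∈ S, |⟪v, u⟫| ≤ ‖v‖ * δ) → ‖u‖ ≤ C * δ := by
  have := hS.fintype
  let f : Submodule.span ℝ S →ₗ[ℝ] (S → ℝ) :=
    LinearMap.pi fun v => (innerₛₗ ℝ (v : E)).comp (Submodule.span ℝ S).subtype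
  have hf : LinearMap.ker f = ⊥ := by
    rw [LinearMap.ker_eq_bot']
    intro u hu
    have h1 : (u : E) ∈ (Submodule.span ℝ S)ᗮ := by
      rw [Submodule.mem_orthogonal]
      intro v hv
      induction hv using Submodule.span_induction with
      | mem v hv => exact congrFun hu ⟨v, hv⟩
      | zero => simp
      | add v w _ _ hv hw => rw [inner_add_left, hv, hw, add_zero]
      | smul t v _ hv => rw [inner_smul_left, hv, mul_zero]
    exact Subtype.ext (inner_self_eq_zero.1 (h1 u u.2) : (u : E) = 0)
  obtain ⟨K, -, hK⟩ := f.exists_antilipschitzWith hf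
  refine ⟨K * ∑ v : S, ‖(v : E)‖, fun u hu δ hδ h => ?_⟩
  have h1 := hK.le_mul_norm (map_zero f) ⟨u, hu⟩
  refine h1.trans ?_
  rw [mul_assoc]
  refine mul_le_mul_of_nonneg_left ?_ K.2
  rw [pi_norm_le_iff_of_nonneg (by positivity)]
  intro v
  refine (h v v.2).trans (mul_le_mul_of_nonneg_right ?_ hδ)
  exact Finset.single_le_sum (f := fun v : S => ‖(v : E)‖) (fun _ _ => norm_nonneg _)
    (Finset.mem_univ v)

theorem exists_forall_subset_norm_le_of_mem_span [FiniteDimensional ℝ E] {A : Set E}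
    (hA : A.Finite) :
    ∃ C : ℝ, 0 < C ∧ ∀ S ⊆ A, ∀ u ∈ Submodule.span ℝ S, ∀ δ : ℝ, 0 ≤ δ →
      (∀ v ∈ S, |⟪v, u⟫| ≤ ‖v‖ * δ) → ‖u‖ ≤ C * δ := by
  have h : ∀ S : Set E, ∃ C : ℝ, S ⊆ A → ∀ u ∈ Submodule.span ℝ S, ∀ δ : ℝ, 0 ≤ δ →
      (∀ v ∈ S, |⟪v, u⟫| ≤ ‖v‖ * δ) → ‖u‖ ≤ C * δ := by
    intro S
    by_cases hS : S ⊆ A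
    · obtain ⟨C, hC⟩ := exists_norm_le_of_mem_span (hA.subset hS)
      exact ⟨C, fun _ => hC⟩
    · exact ⟨0, fun h => absurd h hS⟩
  choose C hC using h
  obtain ⟨B, hB⟩ := (hA.finite_subsets.image C).bddAbove
  refine ⟨max B 1, by positivity, fun S hS u hu δ hδ h => ?_⟩
  refine (hC S hS u hu δ hδ h).trans (mul_le_mul_of_nonneg_right ?_ hδ)
  exact (hB ⟨S, hS, rfl⟩).trans (le_max_left _ _)

/-- The state of Dykstra's algorithm between sweeps: `x k` is the iterate after `k` sweeps, `Q k j`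
the correction attached to the set `D j`, and `w k j` the projection onto `D j` in which that
correction was created. The last field is the descent estimate for the dual gap with respect to
the point `c`. -/
structure DykstraSweeps {ι : Type*} (J : Finset ι) (D : ι → Set E) (h c : E) (x : ℕ → E)
    (Q w : ℕ → ι → E) : Prop where
  mem : ∀ j ∈ J, c ∈ D j
  zero : ∀ j ∈ J, Q 0 j = 0
  eq_add_sum : ∀ k, x k = h + ∑ j ∈ J, Q k j
  proj_mem : ∀ k, ∀ j ∈ J, w (k + 1) j ∈ D j
  normal : ∀ k, ∀ j ∈ J, ∀ y ∈ D j, 0 ≤ ⟪Q k j, y - w k j⟫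
  near : ∀ k, ∀ j ∈ J, ‖w (k + 1) j - x (k + 1)‖ ≤ ∑ i ∈ J, ‖Q (k + 1) i - Q k i‖
  descent : ∀ k, 2⁻¹ * ∑ j ∈ J, ‖Q (k + 1) j - Q k j‖ ^ 2 ≤
    (2⁻¹ * ‖x k - c‖ ^ 2 + ∑ j ∈ J, ⟪Q k j, c - w k j⟫) -
      (2⁻¹ * ‖x (k + 1) - c‖ ^ 2 + ∑ j ∈ J, ⟪Q (k + 1) j, c - w (k + 1) j⟫)

namespace DykstraSweeps

variable {ι : Type*} {J : Finset ι} {D : ι → Set E} {h c : E} {x : ℕ → E} {Q w : ℕ → ι → E}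

/-- The gap between the dual objective after `k` sweeps and its lower bound at `c`. -/
noncomputable def gap (_ : DykstraSweeps J D h c x Q w) (k : ℕ) : ℝ :=
  2⁻¹ * ‖x k - c‖ ^ 2 + ∑ j ∈ J, ⟪Q k j, c - w k j⟫

/-- The total movement of the corrections during a sweep. -/
noncomputable def move (_ : DykstraSweeps J D h c x Q w) (k : ℕ) : ℝ :=
  ∑ j ∈ J, ‖Q (k + 1) j - Q k j‖

theorem move_nonneg (H : DykstraSweeps J D h c x Q w) (k : ℕ) : 0 ≤ H.move k :=
  Finset.sum_nonneg fun _ _ => norm_nonneg _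

theorem sq_norm_le_gap (H : DykstraSweeps J D h c x Q w) (k : ℕ) :
    2⁻¹ * ‖x k - c‖ ^ 2 ≤ H.gap k :=
  le_add_of_nonneg_right (Finset.sum_nonneg fun j hj => H.normal k j hj c (H.mem j hj))

theorem gap_nonneg (H : DykstraSweeps J D h c x Q w) (k : ℕ) : 0 ≤ H.gap k :=
  le_trans (by positivity) (H.sq_norm_le_gap k)

theorem sq_move_le (H : DykstraSweeps J D h c x Q w) (k : ℕ) :
    H.move k ^ 2 ≤ 2 * J.card * (H.gap k - H.gap (k + 1)) := by
  have h1 := sq_sum_le_card_mul_sum_sq (s := J) (f := fun j => ‖Q (k + 1) j - Q k j‖)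
  have h2 := mul_le_mul_of_nonneg_left (H.descent k) (Nat.cast_nonneg (α := ℝ) J.card)
  unfold move gap
  linarith

theorem antitone_gap (H : DykstraSweeps J D h c x Q w) : Antitone H.gap := by
  refine antitone_nat_of_succ_le fun k => ?_
  have h1 : 0 ≤ 2⁻¹ * ∑ j ∈ J, ‖Q (k + 1) j - Q k j‖ ^ 2 := by positivity
  have h2 := H.descent k
  unfold gap
  linarith

theorem sum_sq_move_le (H : DykstraSweeps J D h c x Q w) (n : ℕ) :
    ∑ k ∈ Finset.range n, H.move k ^ 2 ≤ 2 * J.card * H.gap 0 := by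
  have h1 : ∑ k ∈ Finset.range n, H.move k ^ 2 ≤
      ∑ k ∈ Finset.range n, 2 * J.card * (H.gap k - H.gap (k + 1)) :=
    Finset.sum_le_sum fun k _ => H.sq_move_le k
  rw [← Finset.mul_sum, Finset.sum_range_sub'] at h1
  have h2 := mul_nonneg (by positivity : (0 : ℝ) ≤ 2 * J.card) (H.gap_nonneg n)
  linarith

theorem tendsto_move (H : DykstraSweeps J D h c x Q w) : Tendsto H.move atTop (𝓝 0) := by
  have h1 := (summable_of_sum_range_le (fun k => sq_nonneg (H.move k))
    H.sum_sq_move_le).tendsto_atTop_zero.sqrt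
  simpa [Real.sqrt_sq (H.move_nonneg _)] using h1

theorem sum_norm_le (H : DykstraSweeps J D h c x Q w) (k : ℕ) :
    ∑ j ∈ J, ‖Q k j‖ ≤ ∑ m ∈ Finset.range k, H.move m := by
  induction k with
  | zero => exact (Finset.sum_eq_zero fun j hj => by rw [H.zero j hj, norm_zero]).le
  | succ k ih =>
    rw [Finset.sum_range_succ]
    calc ∑ j ∈ J, ‖Q (k + 1) j‖ ≤ ∑ j ∈ J, (‖Q k j‖ + ‖Q (k + 1) j - Q k j‖) :=
          Finset.sum_le_sum fun j _ => norm_le_norm_add_norm_sub' _ _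
      _ = ∑ j ∈ J, ‖Q k j‖ + H.move k := Finset.sum_add_distrib
      _ ≤ _ := by gcongr

theorem gap_succ_le (H : DykstraSweeps J D h c x Q w) (k : ℕ) :
    H.gap (k + 1) ≤ H.move k * ∑ m ∈ Finset.range (k + 1), H.move m + ⟪h - c, x (k + 1) - c⟫ := by
  have h1 : ∑ j ∈ J, ⟪Q (k + 1) j, x (k + 1) - w (k + 1) j⟫ ≤
      H.move k * ∑ m ∈ Finset.range (k + 1), H.move m := by
    calc ∑ j ∈ J, ⟪Q (k + 1) j, x (k + 1) - w (k + 1) j⟫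
        ≤ ∑ j ∈ J, H.move k * ‖Q (k + 1) j‖ := Finset.sum_le_sum fun j hj => by
          refine (real_inner_le_norm _ _).trans ?_
          rw [mul_comm, norm_sub_rev]
          exact mul_le_mul_of_nonneg_right (H.near k j hj) (norm_nonneg _)
      _ = H.move k * ∑ j ∈ J, ‖Q (k + 1) j‖ := by rw [Finset.mul_sum]
      _ ≤ _ := mul_le_mul_of_nonneg_left (H.sum_norm_le (k + 1)) (H.move_nonneg k)
  have h2 : ∑ j ∈ J, ⟪Q (k + 1) j, c - w (k + 1) j⟫ =
      ∑ j ∈ J, ⟪Q (k + 1) j, x (k + 1) - w (k + 1) j⟫ + ⟪x (k + 1) - h, c - x (k + 1)⟫ := by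
    have h3 : x (k + 1) - h = ∑ j ∈ J, Q (k + 1) j := by rw [H.eq_add_sum, add_sub_cancel_left]
    rw [h3, sum_inner, ← Finset.sum_add_distrib]
    refine Finset.sum_congr rfl fun j _ => ?_
    rw [← inner_add_right]
    congr 1
    abel
  have h4 : ⟪x (k + 1) - h, c - x (k + 1)⟫ = ⟪h - c, x (k + 1) - c⟫ - ‖x (k + 1) - c‖ ^ 2 := by
    rw [← real_inner_self_eq_norm_sq, ← inner_sub_left, ← neg_sub (x (k + 1)) c, inner_neg_right,
      ← inner_neg_left]
    congr 1
    abel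
  unfold gap
  rw [h2, h4]
  nlinarith [sq_nonneg ‖x (k + 1) - c‖]

theorem tendsto_proj (H : DykstraSweeps J D h c x Q w) {p : E}
    {φ : ℕ → ℕ} (hφ : Tendsto φ atTop atTop)
    (hx : Tendsto (fun n => x (φ n + 1)) atTop (𝓝 p)) {j : ι} (hj : j ∈ J) :
    Tendsto (fun n => w (φ n + 1) j) atTop (𝓝 p) := by
  have h1 : Tendsto (fun n => w (φ n + 1) j - x (φ n + 1)) atTop (𝓝 0) :=
    squeeze_zero_norm (fun n => H.near (φ n) j hj) (H.tendsto_move.comp hφ)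
  simpa using h1.add hx

/-- The dual gap tends to zero when `c` is the projection of `h` onto the intersection. -/
theorem tendsto_gap [FiniteDimensional ℝ E] (H : DykstraSweeps J D h c x Q w)
    (hD : ∀ j ∈ J, IsClosed (D j)) (hc : ∀ y, (∀ j ∈ J, y ∈ D j) → ⟪h - c, y - c⟫ ≤ 0) :
    Tendsto H.gap atTop (𝓝 0) := by
  choose κ hκ hκlt using fun n : ℕ => exists_mul_sum_range_lt H.sum_sq_move_le
    (Nat.one_div_pos_of_nat (α := ℝ) (n := n)) n
  have hbdd : ∀ n, x (κ n + 1) ∈ Metric.closedBall c (2 * H.gap 0 + 1) := by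
    intro n
    have h1 := H.sq_norm_le_gap (κ n + 1)
    have h2 := H.antitone_gap (Nat.zero_le (κ n + 1))
    rw [mem_closedBall_iff_norm]
    nlinarith [sq_nonneg (‖x (κ n + 1) - c‖ - 1)]
  obtain ⟨p, -, ψ, hψ, hp⟩ := tendsto_subseq_of_bounded Metric.isBounded_closedBall hbdd
  have hφ : Tendsto (fun n => κ (ψ n)) atTop atTop :=
    (tendsto_atTop_mono hκ tendsto_id).comp hψ.tendsto_atTop
  have hpD : ∀ j ∈ J, p ∈ D j := fun j hj =>
    (hD j hj).mem_of_tendsto (H.tendsto_proj hφ hp hj)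
      (Eventually.of_forall fun n => H.proj_mem _ j hj)
  have hsmall : Tendsto (fun n => 1 / ((ψ n : ℝ) + 1)) atTop (𝓝 0) :=
    tendsto_one_div_add_atTop_nhds_zero_nat.comp hψ.tendsto_atTop
  have hinner : Tendsto (fun n => ⟪h - c, x (κ (ψ n) + 1) - c⟫) atTop (𝓝 ⟪h - c, p - c⟫) :=
    tendsto_const_nhds.inner (hp.sub_const c)
  have hlim := tendsto_atTop_ciInf H.antitone_gap ⟨0, Set.forall_mem_range.2 H.gap_nonneg⟩
  have hle : ⨅ k, H.gap k ≤ 0 + ⟪h - c, p - c⟫ := by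
    refine le_of_tendsto_of_tendsto (hlim.comp ((tendsto_add_atTop_nat 1).comp hφ))
      (hsmall.add hinner) (Eventually.of_forall fun n => ?_)
    exact (H.gap_succ_le _).trans (by
      simp only [add_le_add_iff_right]
      exact (hκlt (ψ n)).le)
  have h0 : ⨅ k, H.gap k = 0 :=
    le_antisymm (by linarith [hc p hpD]) (le_ciInf H.gap_nonneg)
  rwa [h0] at hlim

theorem tendsto_iterate (H : DykstraSweeps J D h c x Q w) (hgap : Tendsto H.gap atTop (𝓝 0)) :
    Tendsto x atTop (𝓝 c) := by
  rw [tendsto_iff_norm_sub_tendsto_zero]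
  have h1 : Tendsto (fun k => ‖x k - c‖ ^ 2) atTop (𝓝 0) := by
    refine squeeze_zero (fun k => sq_nonneg _) (fun k => ?_) (by simpa using hgap.const_mul 2)
    linarith [H.sq_norm_le_gap k]
  simpa [Real.sqrt_sq (norm_nonneg _)] using h1.sqrt

/-- For polyhedra, the dual gap is eventually bounded by the squared movement of a sweep. -/
theorem exists_eventually_gap_le [FiniteDimensional ℝ E] (H : DykstraSweeps J D h c x Q w)
    {n : ι → ℕ} {a : (j : ι) → Fin (n j) → E} {b : (j : ι) → Fin (n j) → ℝ}
    (hD : ∀ j ∈ J, D j = {y | ∀ i, ⟪a j i, y⟫ ≤ b j i}) (hx : Tendsto x atTop (𝓝 c)) :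
    ∃ C : ℝ, 0 < C ∧ ∀ᶠ k in atTop, H.gap (k + 1) ≤ C * H.move k ^ 2 := by
  let A : Set E := ⋃ j ∈ J, Set.range (a j)
  have hA : A.Finite := J.finite_toSet.biUnion fun j _ => Set.finite_range (a j)
  let S : ℕ → Set E := fun k => {v | ∃ j ∈ J, ∃ i, v = a j i ∧ ⟪a j i, w (k + 1) j⟫ = b j i}
  have hSA : ∀ k, S k ⊆ A := by
    rintro k _ ⟨j, hj, i, rfl, -⟩
    exact Set.mem_biUnion hj ⟨i, rfl⟩
  have hmem : ∀ k, ∀ j ∈ J, ∀ i, ⟪a j i, w (k + 1) j⟫ ≤ b j i := by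
    intro k j hj
    have h1 := H.proj_mem k j hj
    rwa [hD j hj] at h1
  have hspan : ∀ k, ∀ j ∈ J,
      Q (k + 1) j ∈ Submodule.span ℝ {v | ∃ i, v = a j i ∧ ⟪a j i, w (k + 1) j⟫ = b j i} := by
    intro k j hj
    refine mem_span_active_of_inner_nonneg (hmem k j hj) fun y hy => H.normal _ j hj y ?_
    rw [hD j hj]
    exact hy
  have hspanS : ∀ k, x (k + 1) - h ∈ Submodule.span ℝ (S k) := by
    intro k
    rw [H.eq_add_sum, add_sub_cancel_left]
    refine Submodule.sum_mem _ fun j hj => Submodule.span_mono ?_ (hspan k j hj)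
    rintro v ⟨i, hi⟩
    exact ⟨j, hj, i, hi⟩
  have hx1 : Tendsto (fun k => x (k + 1)) atTop (𝓝 c) := hx.comp (tendsto_add_atTop_nat 1)
  have hactive : ∀ᶠ k in atTop, ∀ j ∈ J, ∀ i, ⟪a j i, w (k + 1) j⟫ = b j i → ⟪a j i, c⟫ = b j i := by
    rw [Filter.eventually_all_finset]
    intro j hj
    have hcj := H.mem j hj
    rw [hD j hj] at hcj
    exact (H.tendsto_proj tendsto_id hx1 hj).eventually (eventually_forall_inner_eq_imp hcj)
  have hlimit : ∀ᶠ k in atTop, ∀ T ∈ {T | T ⊆ A}, S k = T → c - h ∈ Submodule.span ℝ T := by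
    rw [Filter.eventually_all_finite hA.finite_subsets]
    intro T _
    by_cases hT : c - h ∈ Submodule.span ℝ T
    · exact Eventually.of_forall fun _ _ => hT
    · by_contra hcon
      refine hT ((Submodule.closed_of_finiteDimensional _).mem_of_frequently_of_tendsto
        ((not_eventually.1 hcon).mono fun k hk => ?_) (hx1.sub_const h))
      push Not at hk
      exact hk.1 ▸ hspanS k
  obtain ⟨C, hC, hbound⟩ := exists_forall_subset_norm_le_of_mem_span hA
  refine ⟨2⁻¹ * C ^ 2, by positivity, ?_⟩
  filter_upwards [hactive, hlimit] with k hk1 hk2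
  have horth : ∀ j ∈ J, ⟪Q (k + 1) j, c - w (k + 1) j⟫ = 0 := by
    intro j hj
    have h1 := hspan k j hj
    generalize Q (k + 1) j = q at h1
    induction h1 using Submodule.span_induction with
    | mem v hv =>
      obtain ⟨i, rfl, hi⟩ := hv
      rw [inner_sub_right, hi, hk1 j hj i hi, sub_self]
    | zero => simp
    | add u v _ _ hu hv => rw [inner_add_left, hu, hv, add_zero]
    | smul t v _ hv => rw [inner_smul_left, hv, mul_zero]
  have hnorm : ‖x (k + 1) - c‖ ≤ C * H.move k := by
    refine hbound (S k) (hSA k) _ ?_ _ (H.move_nonneg k) ?_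
    · rw [← sub_sub_sub_cancel_right _ _ h]
      exact Submodule.sub_mem _ (hspanS k) (hk2 _ (hSA k) rfl)
    · rintro _ ⟨j, hj, i, rfl, hi⟩
      have h1 : ⟪a j i, x (k + 1) - c⟫ = ⟪a j i, x (k + 1) - w (k + 1) j⟫ := by
        rw [inner_sub_right, inner_sub_right, hi, hk1 j hj i hi]
      rw [h1]
      refine (abs_real_inner_le_norm _ _).trans
        (mul_le_mul_of_nonneg_left ?_ (norm_nonneg _))
      rw [norm_sub_rev]
      exact H.near k j hj
  have hgap : H.gap (k + 1) = 2⁻¹ * ‖x (k + 1) - c‖ ^ 2 := by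
    rw [gap, Finset.sum_eq_zero horth, add_zero]
  rw [hgap, mul_assoc, ← mul_pow]
  gcongr

/-- The iterates of Dykstra's algorithm for polyhedra converge geometrically. -/
theorem exists_norm_sub_le [FiniteDimensional ℝ E] (H : DykstraSweeps J D h c x Q w)
    {n : ι → ℕ} {a : (j : ι) → Fin (n j) → E} {b : (j : ι) → Fin (n j) → ℝ}
    (hD : ∀ j ∈ J, D j = {y | ∀ i, ⟪a j i, y⟫ ≤ b j i})
    (hc : ∀ y, (∀ j ∈ J, y ∈ D j) → ⟪h - c, y - c⟫ ≤ 0) :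
    ∃ ρ : ℝ, 0 < ρ ∧ ∃ r : ℝ, 0 ≤ r ∧ r < 1 ∧ ∀ k, ‖x k - c‖ ≤ ρ * r ^ k := by
  have hclosed : ∀ j ∈ J, IsClosed (D j) := fun j hj =>
    hD j hj ▸ isClosed_setOf_forall_inner_le (a j) (b j)
  obtain ⟨C, hC, hev⟩ :=
    H.exists_eventually_gap_le hD (H.tendsto_iterate (H.tendsto_gap hclosed hc))
  obtain ⟨L, hL0, hL⟩ : ∃ L : ℝ, 0 < L ∧ C * (2 * J.card) ≤ L :=
    ⟨C * (2 * J.card) + 1, by positivity, by linarith⟩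
  have hr0 : 0 < L / (1 + L) := by positivity
  have hr1 : L / (1 + L) < 1 := by rw [div_lt_one (by positivity)]; linarith
  have hstep : ∀ᶠ k in atTop, H.gap (k + 1) ≤ L / (1 + L) * H.gap k := by
    filter_upwards [hev] with k hk
    have h1 := mul_le_mul_of_nonneg_left (H.sq_move_le k) hC.le
    have h2 := mul_le_mul_of_nonneg_right hL
      (sub_nonneg.2 (H.antitone_gap (Nat.le_succ k)))
    rw [div_mul_eq_mul_div, le_div_iff₀ (by positivity)]
    simp only [Nat.succ_eq_add_one] at h2
    nlinarith
  obtain ⟨B, hB, hgap⟩ :=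
    exists_le_mul_pow_of_eventually_le hr0 hstep H.antitone_gap hr1 (H.gap_nonneg 0)
  refine ⟨√(2 * B), by positivity, √(L / (1 + L)), Real.sqrt_nonneg _, ?_, fun k => ?_⟩
  · rw [Real.sqrt_lt' one_pos, one_pow]
    exact hr1
  · refine le_of_sq_le_sq ?_ (by positivity)
    rw [mul_pow, ← pow_mul, mul_comm k, pow_mul, Real.sq_sqrt (by positivity),
      Real.sq_sqrt hr0.le]
    linarith [H.sq_norm_le_gap k, hgap k]

end DykstraSweeps

/-- A telescoping identity over the integer interval `[1, j]`. -/
theorem sum_Icc_one_sub {G : Type*} [AddCommGroup G] (f : ℕ → G) (j : ℕ) :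
    ∑ i ∈ Finset.Icc 1 j, (f i - f (i - 1)) = f j - f 0 := by
  induction j with
  | zero => simp
  | succ j ih => rw [Finset.sum_Icc_succ_top (by omega), ih]; simp

/-- Cyclic projections with Dykstra's corrections form a `DykstraSweeps` system. -/
theorem dykstraSweeps_of_projections {M : ℕ} {D : ℕ → Set E}
    (hconv : ∀ j ∈ Finset.Icc 1 M, Convex ℝ (D j)) {P : ℕ → E → E}
    (hP : ∀ j ∈ Finset.Icc 1 M, ∀ x : E, P j x ∈ D j ∧ ∀ y ∈ D j, ‖P j x - x‖ ≤ ‖y - x‖)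
    {h : E} {a Q : ℕ → ℕ → E} (ha00 : a 0 0 = h) (hQ0 : ∀ j ∈ Finset.Icc 1 M, Q 0 j = 0)
    (hstepa : ∀ k : ℕ, ∀ j ∈ Finset.Icc 1 M, a k j = P j (a k (j - 1) - Q k j))
    (hstepQ : ∀ k : ℕ, ∀ j ∈ Finset.Icc 1 M, Q (k + 1) j = a k j - (a k (j - 1) - Q k j))
    (hcycle : ∀ k : ℕ, a (k + 1) 0 = a k M) {c : E} (hc : ∀ j ∈ Finset.Icc 1 M, c ∈ D j) :
    DykstraSweeps (Finset.Icc 1 M) D h c (fun k => a k 0) Q (fun k j => a (k - 1) j) := by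
  have hdiff : ∀ k, ∀ j ∈ Finset.Icc 1 M, Q (k + 1) j - Q k j = a k j - a k (j - 1) := by
    intro k j hj
    rw [hstepQ k j hj]
    abel
  have hproj : ∀ k, ∀ j ∈ Finset.Icc 1 M, a k j ∈ D j := fun k j hj =>
    hstepa k j hj ▸ (hP j hj _).1
  have hnormal : ∀ k, ∀ j ∈ Finset.Icc 1 M, ∀ y ∈ D j, 0 ≤ ⟪Q k j, y - a (k - 1) j⟫ := by
    intro k j hj y hy
    cases k with
    | zero => rw [hQ0 j hj, inner_zero_left]
    | succ k =>
      rw [Nat.add_sub_cancel, hstepQ k j hj]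
      refine inner_sub_nonneg_of_forall_norm_le (hconv j hj) (hproj k j hj) ?_ hy
      rw [hstepa k j hj]
      exact (hP j hj _).2
  have hsweep : ∀ k, ∑ j ∈ Finset.Icc 1 M, (Q (k + 1) j - Q k j) = a (k + 1) 0 - a k 0 := by
    intro k
    rw [Finset.sum_congr rfl (hdiff k), sum_Icc_one_sub, hcycle]
  refine ⟨hc, hQ0, fun k => ?_, fun k => hproj k, hnormal, fun k j hj => ?_, fun k => ?_⟩
  · induction k with
    | zero => rw [Finset.sum_eq_zero hQ0, add_zero, ha00]
    | succ k ih =>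
      have h1 := hsweep k
      rw [Finset.sum_sub_distrib, ih] at h1
      exact (eq_add_of_sub_eq h1.symm).trans (by abel)
  · have hjM := (Finset.mem_Icc.1 hj).2
    have h1 : a k j - a k M = -∑ i ∈ Finset.Ioc j M, (Q (k + 1) i - Q k i) := by
      have h2 := Finset.sum_Ioc_consecutive (fun i => Q (k + 1) i - Q k i) (Nat.zero_le j) hjM
      have h3 : ∀ l ≤ M, ∑ i ∈ Finset.Ioc 0 l, (Q (k + 1) i - Q k i) = a k l - a k 0 := by
        intro l hl
        rw [← sum_Icc_one_sub (a k)]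
        exact Finset.sum_congr rfl fun i hi =>
          hdiff k i (Finset.Icc_subset_Icc_right hl hi)
      rw [h3 j hjM, h3 M le_rfl] at h2
      rw [eq_sub_of_add_eq' h2]
      abel
    simp only [Nat.add_sub_cancel]
    rw [hcycle, h1, norm_neg]
    refine (norm_sum_le _ _).trans (Finset.sum_le_sum_of_subset_of_nonneg ?_
      fun _ _ _ => norm_nonneg _)
    intro i hi
    rw [Finset.mem_Ioc] at hi
    exact Finset.mem_Icc.2 ⟨by omega, hi.2⟩
  · have h1 : ‖a k 0 - c‖ ^ 2 - ‖a (k + 1) 0 - c‖ ^ 2 = ∑ j ∈ Finset.Icc 1 M,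
        (‖Q (k + 1) j - Q k j‖ ^ 2 + 2 * ⟪Q (k + 1) j - Q k j, c - a k j⟫) := by
      have h2 := sum_Icc_one_sub (fun j => -‖a k j - c‖ ^ 2) M
      rw [hcycle]
      rw [neg_sub_neg] at h2
      rw [← h2]
      refine Finset.sum_congr rfl fun j hj => ?_
      have h3 : a k (j - 1) - c = -(c - a k j) - (Q (k + 1) j - Q k j) := by
        rw [hdiff k j hj]
        abel
      rw [h3, norm_sub_rev (a k j), norm_sub_sq_real (-(c - a k j)), norm_neg, inner_neg_left,
        real_inner_comm]
      ring
    have h2 : ∀ j ∈ Finset.Icc 1 M, ⟪Q (k + 1) j, c - a k j⟫ ≤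
        ⟪Q k j, c - a (k - 1) j⟫ + ⟪Q (k + 1) j - Q k j, c - a k j⟫ := by
      intro j hj
      have h3 := hnormal k j hj _ (hproj k j hj)
      simp only [inner_sub_right, inner_sub_left] at h3 ⊢
      linarith
    have h4 := Finset.sum_le_sum h2
    rw [Finset.sum_add_distrib] at h4
    rw [Finset.sum_add_distrib, ← Finset.mul_sum] at h1
    simp only [Nat.add_sub_cancel]
    linarith

end InnerProduct

/-- Geometric convergence of Dykstra's cyclic projection algorithm for
polyhedra (Theorem 2.5). -/
theorem dykstra_geometric_convergence
    {E : Type*} [NormedAddCommGroup E] [InnerProductSpace ℝ E]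
    [FiniteDimensional ℝ E]
    (M : ℕ) (hM : 1 ≤ M) (D : ℕ → Set E)
    -- each D_j is a nonempty polyhedron (finite intersection of half-spaces)
    (hpoly : ∀ j ∈ Finset.Icc 1 M, (D j).Nonempty ∧
      ∃ (n : ℕ) (a : Fin n → E) (b : Fin n → ℝ),
        D j = {x : E | ∀ i : Fin n, ⟪a i, x⟫ ≤ b i})
    -- the intersection is nonempty
    (hne : (⋂ j ∈ Finset.Icc 1 M, D j).Nonempty)
    -- metric projections onto the individual sets
    (P : ℕ → E → E)
    (hP : ∀ j ∈ Finset.Icc 1 M, ∀ x : E,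
      P j x ∈ D j ∧ ∀ y ∈ D j, ‖P j x - x‖ ≤ ‖y - x‖)
    -- Dykstra iterates:  a k j = h_{k,j},  Q k j = Q_{k-1,j}  (so Q 0 j = Q_{-1,j} = 0)
    (h : E) (a : ℕ → ℕ → E) (Q : ℕ → ℕ → E)
    (ha00 : a 0 0 = h)
    (hQ0 : ∀ j ∈ Finset.Icc 1 M, Q 0 j = 0)
    (hstepa : ∀ k : ℕ, ∀ j ∈ Finset.Icc 1 M, a k j = P j (a k (j - 1) - Q k j))
    (hstepQ : ∀ k : ℕ, ∀ j ∈ Finset.Icc 1 M,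
      Q (k + 1) j = a k j - (a k (j - 1) - Q k j))
    (hcycle : ∀ k : ℕ, a (k + 1) 0 = a k M)
    -- the metric projection of h onto the intersection
    (hstar : E) (hstar_mem : hstar ∈ ⋂ j ∈ Finset.Icc 1 M, D j)
    (hstar_proj : ∀ y ∈ ⋂ j ∈ Finset.Icc 1 M, D j, ‖hstar - h‖ ≤ ‖y - h‖) :
    ∃ (ρ : ℝ), 0 < ρ ∧ ∃ c : ℝ, 0 ≤ c ∧ c < 1 ∧
      ∀ k : ℕ, ‖a k 0 - hstar‖ ≤ ρ * c ^ k := by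
  have hpoly' : ∀ j, ∃ (n : ℕ) (α : Fin n → E) (β : Fin n → ℝ), j ∈ Finset.Icc 1 M →
      D j = {x : E | ∀ i : Fin n, ⟪α i, x⟫ ≤ β i} := by
    intro j
    by_cases hj : j ∈ Finset.Icc 1 M
    · obtain ⟨-, n, α, β, hD⟩ := hpoly j hj
      exact ⟨n, α, β, fun _ => hD⟩
    · exact ⟨0, 0, 0, fun h => absurd h hj⟩
  choose n α β hD using hpoly'
  have hconv : ∀ j ∈ Finset.Icc 1 M, Convex ℝ (D j) := fun j hj =>
    hD j hj ▸ convex_setOf_forall_inner_le (α j) (β j)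
  have hmem : ∀ j ∈ Finset.Icc 1 M, hstar ∈ D j := Set.mem_iInter₂.1 hstar_mem
  refine (dykstraSweeps_of_projections hconv hP ha00 hQ0 hstepa hstepQ hcycle
    hmem).exists_norm_sub_le hD fun y hy => ?_
  have h1 := inner_sub_nonneg_of_forall_norm_le
    (convex_iInter₂ hconv) hstar_mem hstar_proj (Set.mem_iInter₂.2 hy)
  rw [← neg_sub hstar h, inner_neg_left]
  linarith
end
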